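/- arXiv:1401.2144 — 10 statements merged into one kernel-verified Lean document; each statement's English description precedes it below -/
import Mathlib

section
/- Let X and Y be real Banach spaces and let N be a monotone, normalized and strictly monotone norm on ℝ². If X has the weak fixed point property and Y has the GGLD property, then the direct sum X ⊕_N Y (i.e., X × Y with the norm ‖(x,y)‖ = N(‖x‖,‖y‖)) has the weak fixed point property. -/
open Filter Topology

section WeakCompactness

variable {E : Type*} [NormedAddCommGroup E] [NormedSpace ℝ E]

theorem continuous_weakSpace_eval (f : StrongDual ℝ E) :
    Continuous fun x : WeakSpace ℝ E => f ((toWeakSpace ℝ E).symm x) :=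
  WeakBilin.eval_continuous (topDualPairing ℝ E).flip f

theorem isClosed_of_isCompact_toWeakSpace_image {K : Set E}
    (hK : IsCompact (toWeakSpace ℝ E '' K)) : IsClosed K := by
  have h := hK.isClosed.preimage (toWeakSpaceCLM ℝ E).continuous
  rwa [show (toWeakSpaceCLM ℝ E) ⁻¹' (toWeakSpace ℝ E '' K) = K from
    Set.preimage_image_eq K (toWeakSpace ℝ E).injective] at h

theorem isClosed_toWeakSpace_image {Q : Set E} (hQ : Convex ℝ Q) (hc : IsClosed Q) :
    IsClosed (toWeakSpace ℝ E '' Q) := by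
  rw [← hc.closure_eq, hQ.toWeakSpace_closure ℝ]
  exact isClosed_closure

/-- A closed convex set contains the weak limits of its sequences. -/
theorem mem_of_weak_tendsto {Q : Set E} (hQ : Convex ℝ Q) (hc : IsClosed Q) {w : ℕ → E} {z : E}
    (hw : ∀ f : StrongDual ℝ E, Tendsto (fun n => f (w n)) atTop (𝓝 (f z)))
    (hmem : ∃ᶠ n in atTop, w n ∈ Q) : z ∈ Q := by
  by_contra hz
  obtain ⟨f, u, hu, huz⟩ := geometric_hahn_banach_closed_point hQ hc hz
  obtain ⟨n, hn, hn'⟩ := (hmem.and_eventually ((hw f).eventually_const_lt huz)).exists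
  exact (hu _ hn).not_gt hn'

theorem exists_norm_le_of_isCompact_toWeakSpace_image {K : Set E}
    (hK : IsCompact (toWeakSpace ℝ E '' K)) : ∃ B : ℝ, ∀ x ∈ K, ‖x‖ ≤ B := by
  obtain ⟨B, hB⟩ := banach_steinhaus
    (g := fun x : K => NormedSpace.inclusionInDoubleDual ℝ E (x : E)) (fun f => by
      obtain ⟨C, hC⟩ := (hK.image (continuous_weakSpace_eval f)).isBounded.exists_norm_le
      exact ⟨C, fun x => hC _ ⟨_, ⟨x, x.2, rfl⟩, rfl⟩⟩)
  refine ⟨B, fun x hx => ?_⟩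
  have := hB ⟨x, hx⟩
  rwa [show ‖NormedSpace.inclusionInDoubleDual ℝ E x‖ = ‖x‖ from
    (NormedSpace.inclusionInDoubleDualLi ℝ).norm_map x] at this

theorem exists_seq_separating_of_isSeparable {V : Submodule ℝ E}
    (hV : TopologicalSpace.IsSeparable (V : Set E)) :
    ∃ g : ℕ → StrongDual ℝ E, ∀ v ∈ V, (∀ k, g k v = 0) → v = 0 := by
  have := hV.separableSpace
  let s : ℕ → V := TopologicalSpace.denseSeq V
  choose g hg1 hg2 using fun k => exists_dual_vector'' ℝ (s k : E)
  refine ⟨g, fun v hv h0 => ?_⟩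
  by_contra hne
  have hpos : 0 < ‖v‖ / 2 := by positivity
  obtain ⟨k, hk⟩ := (TopologicalSpace.denseRange_denseSeq V).exists_dist_lt ⟨v, hv⟩ hpos
  have hk' : ‖v - s k‖ < ‖v‖ / 2 := by simpa [Subtype.dist_eq, dist_eq_norm] using hk
  have h1 : ‖(s k : E)‖ ≤ ‖v - s k‖ := by
    have h2 : g k (s k - v) = ‖(s k : E)‖ := by rw [map_sub, h0, sub_zero, hg2]; rfl
    calc ‖(s k : E)‖ = g k (s k - v) := h2.symm
      _ ≤ ‖g k (s k - v)‖ := Real.le_norm_self _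
      _ ≤ 1 * ‖(s k : E) - v‖ := (g k).le_of_opNorm_le (hg1 k) _
      _ = ‖v - s k‖ := by rw [one_mul, norm_sub_rev]
  have h3 : ‖v‖ ≤ ‖v - s k‖ + ‖(s k : E)‖ := by
    simpa using norm_add_le (v - s k) (s k : E)
  linarith

/-- Sequences in weakly compact sets have weakly convergent subsequences. -/
theorem exists_weak_tendsto_subseq {K : Set E} (hK : IsCompact (toWeakSpace ℝ E '' K))
    {w : ℕ → E} (hw : ∀ n, w n ∈ K) :
    ∃ z ∈ K, ∃ φ : ℕ → ℕ, StrictMono φ ∧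
      ∀ f : StrongDual ℝ E, Tendsto (fun n => f (w (φ n))) atTop (𝓝 (f z)) := by
  let V := (Submodule.span ℝ (Set.range w)).topologicalClosure
  have hwV : ∀ n, w n ∈ V := fun n =>
    Submodule.le_topologicalClosure _ (Submodule.subset_span ⟨n, rfl⟩)
  have hVsep : TopologicalSpace.IsSeparable (V : Set E) :=
    (((Set.countable_range w).isSeparable.span (R := ℝ)).closure)
  obtain ⟨g, hg⟩ := exists_seq_separating_of_isSeparable hVsep
  let Φ : WeakSpace ℝ E → ℕ → ℝ := fun x k => g k ((toWeakSpace ℝ E).symm x)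
  have hΦ : Continuous Φ := continuous_pi fun k => continuous_weakSpace_eval (g k)
  obtain ⟨l, -, φ, hφ, hl⟩ := (hK.image hΦ).tendsto_subseq
    (x := fun n => Φ (toWeakSpace ℝ E (w n))) (fun n => ⟨_, ⟨w n, hw n, rfl⟩, rfl⟩)
  let u : ℕ → WeakSpace ℝ E := fun n => toWeakSpace ℝ E (w (φ n))
  have huK : ∀ n, u n ∈ toWeakSpace ℝ E '' K := fun n => ⟨_, hw _, rfl⟩
  have huV : ∀ n, u n ∈ toWeakSpace ℝ E '' (V : Set E) := fun n => ⟨_, hwV _, rfl⟩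
  have hVc : IsClosed (toWeakSpace ℝ E '' (V : Set E)) :=
    isClosed_toWeakSpace_image V.convex (Submodule.isClosed_topologicalClosure _)
  have hcl : ∀ y, MapClusterPt y atTop u → y ∈ toWeakSpace ℝ E '' (V : Set E) ∧ Φ y = l := by
    intro y hy
    refine ⟨?_, ?_⟩
    · exact isClosed_iff_clusterPt.1 hVc y (ClusterPt.mono hy
        (tendsto_principal.2 (Eventually.of_forall huV)))
    · have h1 : MapClusterPt (Φ y) atTop (Φ ∘ u) := hy.continuousAt_comp hΦ.continuousAt
      have h2 : Tendsto (Φ ∘ u) atTop (𝓝 l) := hl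
      exact eq_of_nhds_neBot (NeBot.mono h1 (inf_le_inf_left _ h2))
  obtain ⟨_, ⟨z, hz, rfl⟩, hzc⟩ := hK.exists_mapClusterPt_of_frequently
    (l := atTop) (f := u) (Frequently.of_forall huK)
  refine ⟨z, hz, φ, hφ, fun f => ?_⟩
  have ht : Tendsto u atTop (𝓝 (toWeakSpace ℝ E z)) := by
    refine hK.tendsto_nhds_of_unique_mapClusterPt (Eventually.of_forall huK) fun y _ hy => ?_
    obtain ⟨⟨a, ha, rfl⟩, hla⟩ := hcl y hy
    obtain ⟨⟨b, hb, hbz⟩, hlb⟩ := hcl _ hzc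
    obtain rfl := (toWeakSpace ℝ E).injective hbz
    congr 1
    refine sub_eq_zero.1 (hg _ (V.sub_mem ha hb) fun k => ?_)
    rw [map_sub, sub_eq_zero]
    exact congrFun (hla.trans hlb.symm) k
  exact ((continuous_weakSpace_eval f).tendsto _).comp ht

/-- A weakly compact convex invariant set contains a minimal one. -/
theorem exists_minimal_invariant {C : Set E} (hne : C.Nonempty) (hconv : Convex ℝ C)
    (hC : IsCompact (toWeakSpace ℝ E '' C)) {T : E → E} (hT : Set.MapsTo T C C) :
    ∃ K ⊆ C, K.Nonempty ∧ Convex ℝ K ∧ IsCompact (toWeakSpace ℝ E '' K) ∧ Set.MapsTo T K K ∧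
      ∀ Q ⊆ K, Q.Nonempty → Convex ℝ Q → IsClosed Q → Set.MapsTo T Q Q → Q = K := by
  let S : Set (Set E) := {K | K ⊆ C ∧ K.Nonempty ∧ Convex ℝ K ∧ IsClosed K ∧ Set.MapsTo T K K}
  have hcpt : ∀ K ∈ S, IsCompact (toWeakSpace ℝ E '' K) := fun K hK =>
    hC.of_isClosed_subset (isClosed_toWeakSpace_image hK.2.2.1 hK.2.2.2.1)
      (Set.image_mono hK.1)
  obtain ⟨K, -, hK⟩ := zorn_superset_nonempty S (fun c hc hchain hcne => by
    refine ⟨⋂₀ c, ⟨?_, ?_, ?_, ?_, ?_⟩, fun s hs => Set.sInter_subset_of_mem hs⟩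
    · obtain ⟨s, hs⟩ := hcne
      exact (Set.sInter_subset_of_mem hs).trans (hc hs).1
    · have : Nonempty ((Set.image (toWeakSpace ℝ E)) '' c) := (hcne.image _).to_subtype
      obtain ⟨y, hy⟩ := IsCompact.nonempty_sInter_of_directed_nonempty_isCompact_isClosed
        (S := (Set.image (toWeakSpace ℝ E)) '' c)
        (by
          rintro _ ⟨a, ha, rfl⟩ _ ⟨b, hb, rfl⟩
          rcases hchain.total ha hb with h | h
          · exact ⟨_, ⟨a, ha, rfl⟩, subset_rfl, Set.image_mono h⟩
          · exact ⟨_, ⟨b, hb, rfl⟩, Set.image_mono h, subset_rfl⟩)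
        (by rintro _ ⟨a, ha, rfl⟩; exact (hc ha).2.1.image _)
        (by rintro _ ⟨a, ha, rfl⟩; exact hcpt a (hc ha))
        (by rintro _ ⟨a, ha, rfl⟩; exact (hcpt a (hc ha)).isClosed)
      refine ⟨(toWeakSpace ℝ E).symm y, fun s hs => ?_⟩
      obtain ⟨x, hx, hxy⟩ := hy _ ⟨s, hs, rfl⟩
      rw [← hxy]
      simpa using hx
    · exact convex_sInter fun s hs => (hc hs).2.2.1
    · exact isClosed_sInter fun s hs => (hc hs).2.2.2.1
    · exact fun x hx s hs => (hc hs).2.2.2.2 (hx s hs)) C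
    ⟨subset_rfl, hne, hconv, isClosed_of_isCompact_toWeakSpace_image hC, hT⟩
  have hKS := hK.prop
  refine ⟨K, hKS.1, hKS.2.1, hKS.2.2.1, hcpt K hKS, hKS.2.2.2.2, fun Q hQK h1 h2 h3 h4 => ?_⟩
  have hQS : Q ∈ S := ⟨hQK.trans hKS.1, h1, h2, h3, h4⟩
  exact hQK.antisymm (hK.le_of_le hQS hQK)

end WeakCompactness

section Seminorm

variable {E : Type*} [NormedAddCommGroup E] [NormedSpace ℝ E]

theorem Seminorm.convex_combination_sub_le (p : Seminorm ℝ E) {a b : ℝ} (ha : 0 ≤ a) (hb : 0 ≤ b)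
    (x y x' y' : E) :
    p ((a • x + b • y) - (a • x' + b • y')) ≤ a * p (x - x') + b * p (y - y') := by
  have h : (a • x + b • y) - (a • x' + b • y') = a • (x - x') + b • (y - y') := by
    simp only [smul_sub]; abel
  rw [h]
  refine (map_add_le_add p _ _).trans (le_of_eq ?_)
  rw [map_smul_eq_mul, map_smul_eq_mul, Real.norm_of_nonneg ha, Real.norm_of_nonneg hb]

/-- A nonexpansive self-mapping of a bounded convex set has almost fixed points. -/
theorem exists_almost_fixed (p : Seminorm ℝ E) {K : Set E} (hne : K.Nonempty)
    (hconv : Convex ℝ K) {d : ℝ} (hd : ∀ x ∈ K, ∀ y ∈ K, p (x - y) ≤ d) {T : E → E}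
    (hT : Set.MapsTo T K K) (hTp : ∀ x ∈ K, ∀ y ∈ K, p (T x - T y) ≤ p (x - y))
    {ε : ℝ} (hε : 0 < ε) : ∃ w ∈ K, p (T w - w) < ε := by
  obtain ⟨q, hq⟩ := hne
  have hd0 : 0 ≤ d := (apply_nonneg p _).trans (hd q hq q hq)
  obtain ⟨a, ha0, ha1, had⟩ : ∃ a : ℝ, 0 < a ∧ a < 1 ∧ a * d < ε / 2 := by
    refine ⟨min (1 / 2) (ε / (4 * (d + 1))), by positivity,
      (min_le_left _ _).trans_lt (by norm_num), ?_⟩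
    have h := mul_le_mul_of_nonneg_right (min_le_right (1 / 2) (ε / (4 * (d + 1)))) hd0
    refine h.trans_lt ?_
    rw [div_mul_eq_mul_div, div_lt_div_iff₀ (by positivity) (by norm_num)]
    nlinarith
  let R : E → E := fun x => a • q + (1 - a) • T x
  have hR : Set.MapsTo R K K := fun x hx =>
    hconv hq (hT hx) ha0.le (by linarith) (by ring)
  have hRp : ∀ x ∈ K, ∀ y ∈ K, p (R x - R y) ≤ (1 - a) * p (x - y) := by
    intro x hx y hy
    refine (p.convex_combination_sub_le ha0.le (by linarith) _ _ _ _).trans ?_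
    rw [sub_self, map_zero, mul_zero, zero_add]
    exact mul_le_mul_of_nonneg_left (hTp x hx y hy) (by linarith)
  have hmem : ∀ k, R^[k] q ∈ K := fun k => hR.iterate k hq
  have hit : ∀ k, p (R (R^[k] q) - R^[k] q) ≤ (1 - a) ^ k * d := by
    intro k
    induction k with
    | zero => simpa using hd _ (hR hq) _ hq
    | succ k ih =>
      rw [Function.iterate_succ_apply', pow_succ']
      refine (hRp _ (hR (hmem k)) _ (hmem k)).trans ?_
      rw [mul_assoc]
      exact mul_le_mul_of_nonneg_left ih (by linarith)
  have hlim : Tendsto (fun k => (1 - a) ^ k * d) atTop (𝓝 (0 * d)) :=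
    (tendsto_pow_atTop_nhds_zero_of_lt_one (by linarith) (by linarith)).mul_const d
  rw [zero_mul] at hlim
  obtain ⟨k, hk⟩ := (hlim.eventually_lt_const (half_pos hε)).exists
  refine ⟨R^[k] q, hmem k, ?_⟩
  set x := R^[k] q
  have h1 : T x - x = a • (T x - q) + (R x - x) := by
    simp only [R, smul_sub, sub_smul, one_smul]; abel
  rw [h1]
  refine (map_add_le_add p _ _).trans_lt ?_
  rw [map_smul_eq_mul, Real.norm_of_nonneg ha0.le]
  have h2 := mul_le_mul_of_nonneg_left (hd _ (hT (hmem k)) _ hq) ha0.le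
  linarith [hit k]

/-- **Goebel–Karlovitz lemma**: almost fixed point sequences in a minimal invariant set are
asymptotically diametral. -/
theorem eventually_lt_of_minimal (p : Seminorm ℝ E) (hp : Continuous p) {K : Set E}
    (hconv : Convex ℝ K) (hK : IsCompact (toWeakSpace ℝ E '' K)) {T : E → E}
    (hT : Set.MapsTo T K K) (hTp : ∀ x ∈ K, ∀ y ∈ K, p (T x - T y) ≤ p (x - y))
    (hmin : ∀ Q ⊆ K, Q.Nonempty → Convex ℝ Q → IsClosed Q → Set.MapsTo T Q Q → Q = K)
    {d : ℝ} (hd : ∀ s < d, ∃ x ∈ K, ∃ y ∈ K, s < p (x - y))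
    {w : ℕ → E} (hw : ∀ n, w n ∈ K) (hTw : Tendsto (fun n => p (T (w n) - w n)) atTop (𝓝 0))
    {x : E} (hx : x ∈ K) {s : ℝ} (hs : s < d) : ∀ᶠ n in atTop, s < p (w n - x) := by
  by_contra hcon
  have hKc : IsClosed K := isClosed_of_isCompact_toWeakSpace_image hK
  obtain ⟨φ, hφ, hφs⟩ := extraction_of_frequently_atTop (not_eventually.1 hcon)
  simp only [not_lt] at hφs
  have hTw' := hTw.comp hφ.tendsto_atTop
  have htri : ∀ a b c : E, p (a - c) ≤ p (a - b) + p (b - c) := fun a b c => by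
    simpa using map_add_le_add p (a - b) (b - c)
  -- every point of `K` is asymptotically within `s` of the subsequence
  let Q : Set E := {z | z ∈ K ∧ ∀ ε > 0, ∀ᶠ n in atTop, p (w (φ n) - z) ≤ s + ε}
  have hQ : Q = K := by
    refine hmin Q (fun z hz => hz.1)
      ⟨x, hx, fun ε hε => Eventually.of_forall fun n => by linarith [hφs n]⟩ ?_ ?_ ?_
    · intro z hz z' hz' a b ha hb hab
      refine ⟨hconv hz.1 hz'.1 ha hb hab, fun ε hε => ?_⟩
      filter_upwards [hz.2 ε hε, hz'.2 ε hε] with n h1 h2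
      have h := p.convex_combination_sub_le ha hb (w (φ n)) (w (φ n)) z z'
      rw [← add_smul, hab, one_smul] at h
      have h3 := mul_le_mul_of_nonneg_left h1 ha
      have h4 := mul_le_mul_of_nonneg_left h2 hb
      have h5 : a * (s + ε) + b * (s + ε) = s + ε := by rw [← add_mul, hab, one_mul]
      linarith
    · refine isClosed_of_closure_subset fun z hz => ⟨?_, fun ε hε => ?_⟩
      · exact hKc.closure_subset_iff.2 (fun z hz => hz.1) hz
      · have hcont : Continuous fun y => p (y - z) := hp.comp (continuous_id.sub continuous_const)
        have hU : {y | p (y - z) < ε / 2} ∈ 𝓝 z :=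
          (isOpen_lt hcont continuous_const).mem_nhds (by simpa using half_pos hε)
        obtain ⟨y, hy, hyQ⟩ := mem_closure_iff_nhds.1 hz _ hU
        filter_upwards [hyQ.2 (ε / 2) (half_pos hε)] with n hn
        have := htri (w (φ n)) y z
        have hy' : p (y - z) < ε / 2 := hy
        linarith
    · intro z hz
      refine ⟨hT hz.1, fun ε hε => ?_⟩
      filter_upwards [hz.2 (ε / 2) (half_pos hε),
        hTw'.eventually_lt_const (half_pos hε)] with n h1 h2
      have h3 := htri (w (φ n)) (T (w (φ n))) (T z)
      have h4 := hTp _ (hw (φ n)) _ hz.1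
      have h5 : p (w (φ n) - T (w (φ n))) = p (T (w (φ n)) - w (φ n)) := map_sub_rev p _ _
      simp only [Function.comp_apply] at h2
      linarith
  obtain ⟨z₀, hz₀, ψ, hψ, hweak⟩ := exists_weak_tendsto_subseq hK (w := w ∘ φ) fun n => hw _
  have hz₀s : ∀ z ∈ K, p (z₀ - z) ≤ s := by
    intro z hz
    refine le_of_forall_pos_le_add fun ε hε => ?_
    have hball : Convex ℝ {y | p (y - z) ≤ s + ε} := by
      simpa [Seminorm.closedBall] using p.convex_closedBall z (s + ε)
    refine mem_of_weak_tendsto (Q := {y | p (y - z) ≤ s + ε}) hball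
      (isClosed_le (hp.comp (continuous_id.sub continuous_const)) continuous_const) hweak ?_
    exact (hψ.tendsto_atTop.eventually ((hQ.ge hz).2 ε hε)).frequently
  -- the set of centers is all of `K`
  let H : Set E := {z | z ∈ K ∧ ∀ y ∈ K, p (z - y) ≤ s}
  have hTK : closure (convexHull ℝ (T '' K)) = K := by
    have hsub : closure (convexHull ℝ (T '' K)) ⊆ K :=
      hKc.closure_subset_iff.2 (convexHull_min hT.image_subset hconv)
    exact hmin _ hsub ⟨T x, subset_closure (subset_convexHull ℝ _ ⟨x, hx, rfl⟩)⟩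
      (convex_convexHull ℝ _).closure isClosed_closure
      fun z hz => subset_closure (subset_convexHull ℝ _ ⟨z, hsub hz, rfl⟩)
  have hH : H = K := by
    refine hmin H (fun z hz => hz.1) ⟨z₀, hz₀, hz₀s⟩ ?_ ?_ ?_
    · intro z hz z' hz' a b ha hb hab
      refine ⟨hconv hz.1 hz'.1 ha hb hab, fun y hy => ?_⟩
      have h := p.convex_combination_sub_le ha hb z z' y y
      rw [← add_smul a b y, hab, one_smul] at h
      have h3 := mul_le_mul_of_nonneg_left (hz.2 y hy) ha
      have h4 := mul_le_mul_of_nonneg_left (hz'.2 y hy) hb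
      have h5 : a * s + b * s = s := by rw [← add_mul, hab, one_mul]
      linarith
    · have : H = K ∩ ⋂ y ∈ K, {z | p (z - y) ≤ s} := by ext; simp [H]
      rw [this]
      exact hKc.inter (isClosed_biInter fun y _ =>
        isClosed_le (hp.comp (continuous_id.sub continuous_const)) continuous_const)
    · intro z hz
      refine ⟨hT hz.1, fun y hy => ?_⟩
      have hball : Convex ℝ {y | p (y - T z) ≤ s} := by
        simpa [Seminorm.closedBall] using p.convex_closedBall (T z) s
      have hsub : closure (convexHull ℝ (T '' K)) ⊆ {y | p (y - T z) ≤ s} := by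
        refine closure_minimal (convexHull_min ?_ hball)
          (isClosed_le (hp.comp (continuous_id.sub continuous_const)) continuous_const)
        rintro _ ⟨v, hv, rfl⟩
        have h1 := hTp _ hv _ hz.1
        have h2 := hz.2 v hv
        rw [map_sub_rev] at h2
        exact h1.trans h2
      have h := hsub (hTK.ge hy)
      rw [map_sub_rev]
      exact h
  obtain ⟨a, ha, b, hb, hab⟩ := hd s hs
  exact hab.not_ge ((hH.ge ha).2 b hb)

end Seminorm

/-- A normalized, strictly monotone (sub)norm on `ℝ²`, as used to form direct sums. -/
structure IsStrictMonoNorm (N : ℝ × ℝ → ℝ) : Prop where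
  add_le : ∀ p q : ℝ × ℝ, N (p + q) ≤ N p + N q
  smul_eq : ∀ (t : ℝ) (p : ℝ × ℝ), N (t • p) = |t| * N p
  mono : ∀ x₁ y₁ x₂ y₂ : ℝ, 0 ≤ x₁ → x₁ ≤ x₂ → 0 ≤ y₁ → y₁ ≤ y₂ → N (x₁, y₁) ≤ N (x₂, y₂)
  fst_one : N (1, 0) = 1
  snd_one : N (0, 1) = 1
  strict_mono_snd : ∀ x y₁ y₂ : ℝ, 0 ≤ x → 0 ≤ y₁ → y₁ < y₂ → N (x, y₁) < N (x, y₂)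

namespace IsStrictMonoNorm

variable {N : ℝ × ℝ → ℝ}

theorem fst_eq (hN : IsStrictMonoNorm N) (a : ℝ) : N (a, 0) = |a| := by
  have h := hN.smul_eq a (1, 0)
  simpa [hN.fst_one] using h

theorem snd_eq (hN : IsStrictMonoNorm N) (b : ℝ) : N (0, b) = |b| := by
  have h := hN.smul_eq b (0, 1)
  simpa [hN.snd_one] using h

theorem le_abs_add_abs (hN : IsStrictMonoNorm N) (q : ℝ × ℝ) : N q ≤ |q.1| + |q.2| := by
  have h := hN.add_le (q.1, 0) (0, q.2)
  rwa [hN.fst_eq, hN.snd_eq, Prod.mk_add_mk, add_zero, zero_add] at h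

theorem le_add_abs (hN : IsStrictMonoNorm N) (q r : ℝ × ℝ) :
    N q ≤ N r + (|q.1 - r.1| + |q.2 - r.2|) := by
  have h := hN.add_le r (q - r)
  rw [add_sub_cancel] at h
  exact h.trans (add_le_add_right (hN.le_abs_add_abs (q - r)) _)

theorem continuous (hN : IsStrictMonoNorm N) : Continuous N := by
  refine continuous_iff_continuousAt.2 fun r => ?_
  have hlim : Tendsto (fun q : ℝ × ℝ => |q.1 - r.1| + |q.2 - r.2|) (𝓝 r) (𝓝 0) := by
    have h : Continuous fun q : ℝ × ℝ => |q.1 - r.1| + |q.2 - r.2| := by fun_prop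
    simpa using h.tendsto r
  refine tendsto_iff_dist_tendsto_zero.2
    (squeeze_zero (fun _ => dist_nonneg) (fun q => ?_) hlim)
  rw [Real.dist_eq, abs_le]
  have h1 := hN.le_add_abs q r
  have h2 := hN.le_add_abs r q
  rw [abs_sub_comm r.1, abs_sub_comm r.2] at h2
  constructor <;> linarith

/-- Strict monotonicity in the second variable is uniform on bounded sets. -/
theorem exists_gap (hN : IsStrictMonoNorm N) (D : ℝ) {η : ℝ} (hη : 0 < η) :
    ∃ ζ > 0, ∀ a b : ℝ, 0 ≤ a → a ≤ D → 0 ≤ b → b ≤ D → N (a, b) + ζ ≤ N (a, b + η) := by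
  rcases lt_or_ge D 0 with hD | hD
  · exact ⟨1, one_pos, fun a b h1 h2 => absurd (h1.trans h2) hD.not_ge⟩
  have hcont : Continuous fun q : ℝ × ℝ => N (q.1, q.2 + η) - N q := by
    have := hN.continuous
    fun_prop
  obtain ⟨q, hq, hmin⟩ := (isCompact_Icc (a := (0 : ℝ)) (b := D)).prod
    (isCompact_Icc (a := (0 : ℝ)) (b := D)) |>.exists_isMinOn
    ⟨(0, 0), by simp [hD]⟩ hcont.continuousOn
  refine ⟨N (q.1, q.2 + η) - N q, sub_pos.2
    (hN.strict_mono_snd q.1 q.2 _ hq.1.1 hq.2.1 (by linarith)), fun a b h1 h2 h3 h4 => ?_⟩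
  have h : N (q.1, q.2 + η) - N q ≤ N (a, b + η) - N (a, b) :=
    hmin (show (a, b) ∈ Set.Icc (0 : ℝ) D ×ˢ Set.Icc (0 : ℝ) D from ⟨⟨h1, h2⟩, h3, h4⟩)
  linarith

variable (X Y : Type*) [NormedAddCommGroup X] [NormedSpace ℝ X]
  [NormedAddCommGroup Y] [NormedSpace ℝ Y]

/-- The norm of the direct sum `X ⊕_N Y`, as a seminorm on `X × Y`. -/
def seminorm (hN : IsStrictMonoNorm N) : Seminorm ℝ (X × Y) :=
  Seminorm.of (fun w => N (‖w.1‖, ‖w.2‖))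
    (fun v w => (hN.mono _ _ _ _ (norm_nonneg _) (norm_add_le _ _) (norm_nonneg _)
      (norm_add_le _ _)).trans (hN.add_le (‖v.1‖, ‖v.2‖) (‖w.1‖, ‖w.2‖)))
    (fun t w => by
      have h := hN.smul_eq ‖t‖ (‖w.1‖, ‖w.2‖)
      rw [abs_norm] at h
      rw [← h, Prod.smul_fst, Prod.smul_snd, norm_smul, norm_smul]
      rfl)

variable {X Y}

theorem seminorm_apply (hN : IsStrictMonoNorm N) (w : X × Y) :
    hN.seminorm X Y w = N (‖w.1‖, ‖w.2‖) := rfl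

theorem continuous_seminorm (hN : IsStrictMonoNorm N) : Continuous (hN.seminorm X Y) :=
  hN.continuous.comp (by fun_prop : Continuous fun w : X × Y => (‖w.1‖, ‖w.2‖))

theorem norm_fst_le (hN : IsStrictMonoNorm N) (w : X × Y) : ‖w.1‖ ≤ hN.seminorm X Y w := by
  have h := hN.mono ‖w.1‖ 0 ‖w.1‖ ‖w.2‖ (norm_nonneg _) le_rfl le_rfl (norm_nonneg _)
  rwa [hN.fst_eq, abs_norm] at h

theorem norm_snd_le (hN : IsStrictMonoNorm N) (w : X × Y) : ‖w.2‖ ≤ hN.seminorm X Y w := by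
  have h := hN.mono 0 ‖w.2‖ ‖w.1‖ ‖w.2‖ le_rfl (norm_nonneg _) (norm_nonneg _) le_rfl
  rwa [hN.snd_eq, abs_norm] at h

theorem seminorm_le (hN : IsStrictMonoNorm N) (w : X × Y) :
    hN.seminorm X Y w ≤ 2 * ‖w‖ := by
  have h := hN.le_abs_add_abs (‖w.1‖, ‖w.2‖)
  simp only [abs_norm] at h
  have h1 := _root_.norm_fst_le w
  have h2 := _root_.norm_snd_le w
  rw [hN.seminorm_apply]
  linarith

theorem continuousOn_of_nonexpansive (hN : IsStrictMonoNorm N) {K : Set (X × Y)}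
    {G : X × Y → X × Y}
    (hG : ∀ x ∈ K, ∀ y ∈ K, hN.seminorm X Y (G x - G y) ≤ hN.seminorm X Y (x - y)) :
    ContinuousOn G K := by
  have h : LipschitzOnWith 2 G K := LipschitzOnWith.of_dist_le_mul fun x hx y hy => by
    rw [dist_eq_norm, dist_eq_norm]
    exact (max_le (hN.norm_fst_le _) (hN.norm_snd_le _)).trans
      ((hG x hx y hy).trans (hN.seminorm_le _))
  exact h.continuousOn

/-- In a direct sum whose second summand has the GGLD property, a weakly convergent sequence that
is diametral with respect to its weak limit converges in norm in the second coordinate, up to a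
subsequence. -/
theorem exists_subseq_snd_tendsto (hN : IsStrictMonoNorm N)
    (hY : ∀ x : ℕ → Y,
      (∀ f : Y →L[ℝ] ℝ, Tendsto (fun n => f (x n)) atTop (𝓝 0)) →
      Tendsto (fun n => ‖x n‖) atTop (𝓝 1) →
      1 < limsup (fun m => limsup (fun n => ‖x n - x m‖) atTop) atTop)
    {d : ℝ} {w : ℕ → X × Y} {z : X × Y}
    (hweak : ∀ f : StrongDual ℝ (X × Y), Tendsto (fun n => f (w n)) atTop (𝓝 (f z)))
    (hdiam : ∀ n m, hN.seminorm X Y (w n - w m) ≤ d) (hdz : ∀ n, hN.seminorm X Y (w n - z) ≤ d)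
    (hd : ∀ s < d, ∀ᶠ n in atTop, s < hN.seminorm X Y (w n - z)) :
    ∃ φ : ℕ → ℕ, StrictMono φ ∧ Tendsto (fun n => ‖(w (φ n)).2 - z.2‖) atTop (𝓝 0) := by
  obtain ⟨⟨a, b⟩, ⟨⟨ha, -⟩, hb, -⟩, φ, hφ, hlim⟩ :=
    ((isCompact_Icc (a := (0 : ℝ)) (b := d)).prod
      (isCompact_Icc (a := (0 : ℝ)) (b := d))).tendsto_subseq
      (x := fun n => (‖(w n - z).1‖, ‖(w n - z).2‖)) (fun n =>
        ⟨⟨norm_nonneg _, (hN.norm_fst_le _).trans (hdz n)⟩,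
          norm_nonneg _, (hN.norm_snd_le _).trans (hdz n)⟩)
  have hlim1 : Tendsto (fun n => ‖(w (φ n)).1 - z.1‖) atTop (𝓝 a) :=
    (continuous_fst.tendsto (a, b)).comp hlim
  have hlim2 : Tendsto (fun n => ‖(w (φ n)).2 - z.2‖) atTop (𝓝 b) :=
    (continuous_snd.tendsto (a, b)).comp hlim
  rcases hb.eq_or_lt with rfl | hbpos
  · exact ⟨φ, hφ, hlim2⟩
  exfalso
  have hdab : d ≤ N (a, b) := by
    refine le_of_forall_lt fun s hs => ?_
    obtain ⟨t, hst, htd⟩ := exists_between hs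
    exact hst.trans_le (ge_of_tendsto ((hN.continuous.tendsto (a, b)).comp hlim)
      ((hφ.tendsto_atTop.eventually (hd t htd)).mono fun n hn => hn.le))
  let v : ℕ → Y := fun n => b⁻¹ • ((w (φ n)).2 - z.2)
  have hvsub : ∀ n m, ‖v n - v m‖ = b⁻¹ * ‖(w (φ n)).2 - (w (φ m)).2‖ := by
    intro n m
    simp only [v]
    rw [← smul_sub, sub_sub_sub_cancel_right, norm_smul, Real.norm_of_nonneg (by positivity)]
  have hvle : ∀ n m, ‖v n - v m‖ ≤ b⁻¹ * d := fun n m => by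
    rw [hvsub]
    exact mul_le_mul_of_nonneg_left
      ((hN.norm_snd_le (w (φ n) - w (φ m))).trans (hdiam _ _)) (by positivity)
  have hbdd : ∀ m, IsBoundedUnder (· ≤ ·) atTop fun n => ‖v n - v m‖ := fun m =>
    isBoundedUnder_of ⟨b⁻¹ * d, fun n => hvle n m⟩
  have hlt := hY v (fun f => by
      have h := (hweak (f.comp (ContinuousLinearMap.snd ℝ X Y))).comp hφ.tendsto_atTop
      have h' := ((h.sub_const (f z.2)).const_mul b⁻¹)
      simpa [v] using h')
    (by
      have h := hlim2.const_mul b⁻¹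
      rw [inv_mul_cancel₀ hbpos.ne'] at h
      refine h.congr fun n => ?_
      simp only [v]
      rw [norm_smul, Real.norm_of_nonneg (by positivity)])
  obtain ⟨c, hc1, hc⟩ := exists_between hlt
  have hfreq : ∃ᶠ m in atTop, c < limsup (fun n => ‖v n - v m‖) atTop := by
    refine frequently_lt_of_lt_limsup (IsBoundedUnder.isCoboundedUnder_le
      (isBoundedUnder_of ⟨0, fun m => ?_⟩)) hc
    exact le_limsup_of_frequently_le (Frequently.of_forall fun n => norm_nonneg _) (hbdd m)
  have hkey : N (a, b * c) ≤ d := by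
    refine le_of_forall_pos_le_add fun ε hε => ?_
    obtain ⟨m, hm, hma⟩ := (hfreq.and_eventually
      (hlim1.eventually_const_lt (show a - ε / 2 < a by linarith))).exists
    have h1 : ∃ᶠ n in atTop, c < ‖v n - v m‖ :=
      frequently_lt_of_lt_limsup (IsBoundedUnder.isCoboundedUnder_le
        (isBoundedUnder_of ⟨0, fun n => norm_nonneg _⟩)) hm
    have h2 : ∀ᶠ n in atTop, a - ε / 2 < ‖(w (φ n)).1 - (w (φ m)).1‖ := by
      by_contra hcon
      have hmem : z.1 ∈ Metric.closedBall (w (φ m)).1 (a - ε / 2) := by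
        refine mem_of_weak_tendsto (w := fun n => (w (φ n)).1) (convex_closedBall _ _)
          Metric.isClosed_closedBall (fun f =>
            (hweak (f.comp (ContinuousLinearMap.fst ℝ X Y))).comp hφ.tendsto_atTop) ?_
        exact (not_eventually.1 hcon).mono fun n hn => by
          rw [mem_closedBall_iff_norm]
          exact not_lt.1 hn
      rw [mem_closedBall_iff_norm'] at hmem
      linarith
    obtain ⟨n, hn1, hn2⟩ := (h1.and_eventually h2).exists
    rw [hvsub, lt_inv_mul_iff₀ hbpos] at hn1
    have h3 : N (max (a - ε / 2) 0, b * c) ≤ d :=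
      (hN.mono _ _ _ _ (le_max_right _ _) (max_le hn2.le (norm_nonneg _))
        (by positivity) hn1.le).trans (hdiam (φ n) (φ m))
    have h4 := hN.le_add_abs (a, b * c) (max (a - ε / 2) 0, b * c)
    have h5 : |a - max (a - ε / 2) 0| ≤ ε / 2 := by
      rw [abs_le]
      rcases max_cases (a - ε / 2) 0 with ⟨h, h'⟩ | ⟨h, h'⟩ <;> rw [h] <;>
        constructor <;> linarith
    simp only [sub_self, abs_zero] at h4
    linarith
  have := hN.strict_mono_snd a b (b * c) ha hb (by nlinarith)
  linarith

/-- Pointwise asymptotic lower bounds for the distance to a sequence are uniform on compact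
sets. -/
theorem eventually_forall_lt_of_isCompact (hN : IsStrictMonoNorm N) {Q : Set (X × Y)}
    (hQ : IsCompact Q) {d : ℝ} {w : ℕ → X × Y}
    (hd : ∀ x ∈ Q, ∀ s < d, ∀ᶠ n in atTop, s < hN.seminorm X Y (w n - x)) {s : ℝ} (hs : s < d) :
    ∀ᶠ n in atTop, ∀ x ∈ Q, s < hN.seminorm X Y (w n - x) := by
  obtain ⟨t, hst, htd⟩ := exists_between hs
  refine hQ.induction_on (p := fun S => ∀ᶠ n in atTop, ∀ x ∈ S, s < hN.seminorm X Y (w n - x))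
    (by simp) (fun S S' h h' => h'.mono fun n hn x hx => hn x (h hx))
    (fun S S' h h' => by
      filter_upwards [h, h'] with n h1 h2 x hx
      exact hx.elim (h1 x) (h2 x)) fun x hx => ?_
  have hcont : Continuous fun y => hN.seminorm X Y (y - x) :=
    hN.continuous_seminorm.comp (continuous_id.sub continuous_const)
  refine ⟨{y | hN.seminorm X Y (y - x) < t - s}, mem_nhdsWithin_of_mem_nhds
    ((isOpen_lt hcont continuous_const).mem_nhds (by simpa using hst)), ?_⟩
  filter_upwards [hd x hx t htd] with n hn y hy
  have h := map_add_le_add (hN.seminorm X Y) (w n - y) (y - x)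
  rw [sub_add_sub_cancel] at h
  have hy' : hN.seminorm X Y (y - x) < t - s := hy
  linarith

/-- If `G` nearly maps a compact set `Q` into the slice `X × {y₀}`, then it also does so for the
segments joining `Q` to a far term of a diametral sequence that is almost fixed by `G`. -/
theorem eventually_segment_snd_lt (hN : IsStrictMonoNorm N) {K : Set (X × Y)} {d : ℝ}
    (hconv : Convex ℝ K) (hdiam : ∀ x ∈ K, ∀ y ∈ K, hN.seminorm X Y (x - y) ≤ d)
    {w : ℕ → X × Y} (hw : ∀ n, w n ∈ K)
    (hd : ∀ x ∈ K, ∀ s < d, ∀ᶠ n in atTop, s < hN.seminorm X Y (w n - x))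
    {y₀ : Y} (hy₀ : Tendsto (fun n => ‖(w n).2 - y₀‖) atTop (𝓝 0))
    {G : X × Y → X × Y} (hGK : Set.MapsTo G K K)
    (hG : ∀ x ∈ K, ∀ y ∈ K, hN.seminorm X Y (G x - G y) ≤ hN.seminorm X Y (x - y))
    (hGw : Tendsto (fun n => hN.seminorm X Y (G (w n) - w n)) atTop (𝓝 0))
    {Q : Set (X × Y)} (hQ : IsCompact Q) (hQne : Q.Nonempty) (hQK : Q ⊆ K) {ε : ℝ}
    (hQε : ∀ q ∈ Q, ‖(G q).2 - y₀‖ < ε) :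
    ∀ᶠ n in atTop, ∀ q ∈ Q, ∀ a b : ℝ, 0 ≤ a → 0 ≤ b → a + b = 1 →
      ‖(G (a • w n + b • q)).2 - y₀‖ < ε := by
  have hGQ : ContinuousOn G Q := (hN.continuousOn_of_nonexpansive hG).mono hQK
  have hcont : ContinuousOn (fun q => ‖(G q).2 - y₀‖) Q :=
    ((continuous_snd.comp_continuousOn hGQ).sub continuousOn_const).norm
  obtain ⟨q₀, hq₀, hmax⟩ := hQ.exists_isMaxOn hQne hcont
  have hη : 0 < (ε - ‖(G q₀).2 - y₀‖) / 4 := by linarith [hQε q₀ hq₀]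
  set η := (ε - ‖(G q₀).2 - y₀‖) / 4 with hηdef
  obtain ⟨ζ, hζ, hgap⟩ := hN.exists_gap d hη
  have hunif := hN.eventually_forall_lt_of_isCompact (hQ.image_of_continuousOn hGQ) (d := d)
    (w := w) (by rintro _ ⟨q, hq, rfl⟩; exact hd _ (hGK (hQK hq)))
    (show d - ζ / 3 < d by linarith)
  filter_upwards [hunif, hGw.eventually_lt_const (show 0 < ζ / 3 by linarith),
    hy₀.eventually_lt_const hη] with n hn1 hn2 hn3 q hq a b ha hb hab
  have hqK := hQK hq
  set z := a • w n + b • q with hz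
  have hzK : z ∈ K := hconv (hw n) hqK ha hb hab
  have hzw : hN.seminorm X Y (z - w n) ≤ b * d := by
    have h : z - w n = b • (q - w n) := by
      rw [hz, eq_sub_of_add_eq hab, sub_smul, one_smul, smul_sub]; abel
    rw [h, map_smul_eq_mul, Real.norm_of_nonneg hb]
    exact mul_le_mul_of_nonneg_left (hdiam _ hqK _ (hw n)) hb
  have hzq : hN.seminorm X Y (z - q) ≤ a * d := by
    have h : z - q = a • (w n - q) := by
      rw [hz, eq_sub_of_add_eq' hab, sub_smul, one_smul, smul_sub]; abel
    rw [h, map_smul_eq_mul, Real.norm_of_nonneg ha]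
    exact mul_le_mul_of_nonneg_left (hdiam _ (hw n) _ hqK) ha
  have h1 : hN.seminorm X Y (G z - w n) ≤ b * d + ζ / 3 := by
    have h := map_add_le_add (hN.seminorm X Y) (G z - G (w n)) (G (w n) - w n)
    rw [sub_add_sub_cancel] at h
    linarith [hG z hzK (w n) (hw n)]
  have h2 : hN.seminorm X Y (G q - G z) ≤ a * d := by
    rw [map_sub_rev]
    exact (hG z hzK q hqK).trans hzq
  have h3 : d - ζ / 3 < hN.seminorm X Y (G q - w n) := by
    rw [map_sub_rev]
    exact hn1 _ ⟨q, hq, rfl⟩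
  have hsum : b * d + a * d = d := by rw [← add_mul, add_comm, hab, one_mul]
  have hclose : ‖(G z - w n).2‖ < ‖(G q - w n).2‖ + η := by
    by_contra! hcon
    have hqw := hdiam _ (hGK hqK) _ (hw n)
    have h4 := hgap ‖(G q - w n).1‖ ‖(G q - w n).2‖ (norm_nonneg _)
      ((hN.norm_fst_le _).trans hqw) (norm_nonneg _) ((hN.norm_snd_le _).trans hqw)
    have h5 : ‖(G q - w n).1‖ ≤ ‖(G z - w n).1‖ + ‖(G q - G z).1‖ := by
      have h := norm_add_le (G z - w n).1 (G q - G z).1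
      rwa [← Prod.fst_add, add_comm (G z - w n), sub_add_sub_cancel] at h
    have h6 := hN.mono _ (‖(G q - w n).2‖ + η) _ (‖(G z - w n).2‖ + ‖(G q - G z).2‖)
      (norm_nonneg _) h5 (by positivity) (by linarith [norm_nonneg (G q - G z).2])
    have h7 := hN.add_le (‖(G z - w n).1‖, ‖(G z - w n).2‖) (‖(G q - G z).1‖, ‖(G q - G z).2‖)
    rw [Prod.mk_add_mk] at h7
    simp only [seminorm_apply] at h1 h2 h3
    linarith
  have h8 : ‖(G z).2 - y₀‖ ≤ ‖(G z - w n).2‖ + ‖(w n).2 - y₀‖ := by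
    have h := norm_add_le (G z - w n).2 ((w n).2 - y₀)
    rwa [Prod.snd_sub, sub_add_sub_cancel] at h
  have h9 : ‖(G q - w n).2‖ ≤ ‖(G q).2 - y₀‖ + ‖(w n).2 - y₀‖ := by
    have h := norm_sub_le ((G q).2 - y₀) ((w n).2 - y₀)
    rwa [sub_sub_sub_cancel_right] at h
  have h10 : ‖(G q).2 - y₀‖ ≤ ‖(G q₀).2 - y₀‖ := hmax hq
  linarith

/-- A nonexpansive mapping almost fixing a diametral sequence which converges weakly, and in norm
in the second coordinate, preserves the second coordinate of the weak limit. -/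
theorem snd_apply_weak_limit (hN : IsStrictMonoNorm N) {K : Set (X × Y)} {d : ℝ}
    (hconv : Convex ℝ K) (hKc : IsClosed K)
    (hdiam : ∀ x ∈ K, ∀ y ∈ K, hN.seminorm X Y (x - y) ≤ d)
    {w : ℕ → X × Y} (hw : ∀ n, w n ∈ K)
    (hd : ∀ x ∈ K, ∀ s < d, ∀ᶠ n in atTop, s < hN.seminorm X Y (w n - x))
    {z : X × Y}
    (hweak : ∀ f : StrongDual ℝ (X × Y), Tendsto (fun n => f (w n)) atTop (𝓝 (f z)))
    (hy₀ : Tendsto (fun n => ‖(w n).2 - z.2‖) atTop (𝓝 0))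
    {G : X × Y → X × Y} (hGK : Set.MapsTo G K K)
    (hG : ∀ x ∈ K, ∀ y ∈ K, hN.seminorm X Y (G x - G y) ≤ hN.seminorm X Y (x - y))
    (hGw : Tendsto (fun n => hN.seminorm X Y (G (w n) - w n)) atTop (𝓝 0)) :
    (G z).2 = z.2 := by
  rw [← sub_eq_zero, ← norm_le_zero_iff]
  refine le_of_forall_pos_le_add fun ε hε => ?_
  rw [zero_add]
  let Good : Finset ℕ → Prop := fun F =>
    F.Nonempty ∧ ∀ q ∈ convexHull ℝ (w '' F), ‖(G q).2 - z.2‖ < ε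
  have hsubK : ∀ F : Finset ℕ, convexHull ℝ (w '' F) ⊆ K := fun F =>
    convexHull_min (by rintro _ ⟨n, -, rfl⟩; exact hw n) hconv
  have hstart : ∃ F, Good F := by
    have h := hGw.add hy₀
    rw [add_zero] at h
    obtain ⟨n, hn⟩ := (h.eventually_lt_const hε).exists
    refine ⟨{n}, Finset.singleton_nonempty n, fun q hq => ?_⟩
    rw [Finset.coe_singleton, Set.image_singleton, convexHull_singleton] at hq
    obtain rfl : q = w n := hq
    have h1 := norm_add_le (G (w n) - w n).2 ((w n).2 - z.2)
    rw [Prod.snd_sub, sub_add_sub_cancel] at h1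
    have h2 := hN.norm_snd_le (G (w n) - w n)
    rw [Prod.snd_sub] at h2
    linarith
  have hstep : ∀ (k : ℕ) (F : {F // Good F}), ∃ F' : {F // Good F},
      F.1 ⊆ F'.1 ∧ ∃ n ≥ k, n ∈ F'.1 := by
    rintro k ⟨F, hFne, hF⟩
    have hne : (w '' F).Nonempty := (Finset.coe_nonempty.2 hFne).image w
    obtain ⟨n, hn, hnk⟩ := ((hN.eventually_segment_snd_lt hconv hdiam hw hd hy₀ hGK hG hGw
      ((F.finite_toSet.image w).isCompact_convexHull ℝ) (hne.mono (subset_convexHull ℝ _))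
      (hsubK F) hF).and (eventually_ge_atTop k)).exists
    refine ⟨⟨insert n F, Finset.insert_nonempty n F, fun q hq => ?_⟩, Finset.subset_insert n F,
      n, hnk, Finset.mem_insert_self n F⟩
    rw [Finset.coe_insert, Set.image_insert_eq, convexHull_insert hne, mem_convexJoin] at hq
    obtain ⟨_, rfl, r, hr, a, b, ha, hb, hab, rfl⟩ := hq
    exact hn r hr a b ha hb hab
  choose next hnext_sub hnext_mem using hstep
  obtain ⟨F₀, hF₀⟩ := hstart
  let F : ℕ → {F // Good F} := fun k => Nat.rec ⟨F₀, hF₀⟩ (fun k F => next k F) k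
  have hFmono : Monotone fun k => convexHull ℝ (w '' ((F k).1 : Set ℕ)) :=
    monotone_nat_of_le_succ fun k =>
      convexHull_mono (Set.image_mono (Finset.coe_subset.2 (hnext_sub k (F k))))
  let S := ⋃ k, convexHull ℝ (w '' ((F k).1 : Set ℕ))
  have hS : Convex ℝ S := hFmono.directed_le.convex_iUnion fun k => convex_convexHull ℝ _
  have hzS : z ∈ closure S := by
    refine mem_of_weak_tendsto hS.closure isClosed_closure hweak
      (frequently_atTop.2 fun k => ?_)
    obtain ⟨n, hnk, hn⟩ := hnext_mem k (F k)
    exact ⟨n, hnk, subset_closure (Set.mem_iUnion.2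
      ⟨k + 1, subset_convexHull ℝ _ ⟨n, hn, rfl⟩⟩)⟩
  have hSK : S ⊆ K := Set.iUnion_subset fun k => hsubK _
  have hcont : ContinuousOn (fun q => ‖(G q).2 - z.2‖) K :=
    ((continuous_snd.comp_continuousOn (hN.continuousOn_of_nonexpansive hG)).sub
      continuousOn_const).norm
  have hcl : IsClosed {q | q ∈ K ∧ ‖(G q).2 - z.2‖ ≤ ε} :=
    hKc.isClosed_le hcont continuousOn_const
  have hsub : S ⊆ {q | q ∈ K ∧ ‖(G q).2 - z.2‖ ≤ ε} := fun q hq => by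
    obtain ⟨k, hk⟩ := Set.mem_iUnion.1 hq
    exact ⟨hSK hq, ((F k).2.2 q hk).le⟩
  exact (closure_minimal hsub hcl hzS).2

/-- A minimal invariant set of a direct sum whose second summand has the GGLD property is contained
in a slice parallel to the first summand. -/
theorem exists_subset_slice (hN : IsStrictMonoNorm N)
    (hY : ∀ x : ℕ → Y,
      (∀ f : Y →L[ℝ] ℝ, Tendsto (fun n => f (x n)) atTop (𝓝 0)) →
      Tendsto (fun n => ‖x n‖) atTop (𝓝 1) →
      1 < limsup (fun m => limsup (fun n => ‖x n - x m‖) atTop) atTop)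
    {K : Set (X × Y)} (hne : K.Nonempty) (hconv : Convex ℝ K)
    (hK : IsCompact (toWeakSpace ℝ (X × Y) '' K)) {T : X × Y → X × Y} (hT : Set.MapsTo T K K)
    (hTp : ∀ x ∈ K, ∀ y ∈ K, hN.seminorm X Y (T x - T y) ≤ hN.seminorm X Y (x - y))
    (hmin : ∀ Q ⊆ K, Q.Nonempty → Convex ℝ Q → IsClosed Q → Set.MapsTo T Q Q → Q = K) :
    ∃ y₀ : Y, ∀ x ∈ K, x.2 = y₀ := by
  have hKc := isClosed_of_isCompact_toWeakSpace_image hK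
  obtain ⟨B, hB⟩ := exists_norm_le_of_isCompact_toWeakSpace_image hK
  let D : Set ℝ := (fun q : (X × Y) × (X × Y) => hN.seminorm X Y (q.1 - q.2)) '' (K ×ˢ K)
  have hDb : BddAbove D := by
    refine ⟨2 * (B + B), ?_⟩
    rintro _ ⟨⟨x, y⟩, ⟨hx, hy⟩, rfl⟩
    have h := (norm_sub_le x y).trans (add_le_add (hB x hx) (hB y hy))
    exact (hN.seminorm_le _).trans (by linarith)
  have hdiam : ∀ x ∈ K, ∀ y ∈ K, hN.seminorm X Y (x - y) ≤ sSup D := fun x hx y hy =>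
    le_csSup hDb ⟨(x, y), ⟨hx, hy⟩, rfl⟩
  have hsup : ∀ s < sSup D, ∃ x ∈ K, ∃ y ∈ K, s < hN.seminorm X Y (x - y) := by
    intro s hs
    obtain ⟨_, ⟨⟨x, y⟩, ⟨hx, hy⟩, rfl⟩, h⟩ := exists_lt_of_lt_csSup ((hne.prod hne).image _) hs
    exact ⟨x, hx, y, hy, h⟩
  choose u huK hu using fun n : ℕ => exists_almost_fixed (hN.seminorm X Y) hne hconv hdiam hT hTp
    (Nat.one_div_pos_of_nat (α := ℝ) (n := n))
  have hTu : Tendsto (fun n => hN.seminorm X Y (T (u n) - u n)) atTop (𝓝 0) :=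
    squeeze_zero (fun n => apply_nonneg _ _) (fun n => (hu n).le)
      tendsto_one_div_add_atTop_nhds_zero_nat
  have hfar : ∀ x ∈ K, ∀ s < sSup D, ∀ᶠ n in atTop, s < hN.seminorm X Y (u n - x) :=
    fun x hx s hs => eventually_lt_of_minimal _ hN.continuous_seminorm hconv hK hT hTp hmin hsup
      huK hTu hx hs
  obtain ⟨z, hz, φ, hφ, hweak⟩ := exists_weak_tendsto_subseq hK huK
  obtain ⟨ψ, hψ, hy⟩ := hN.exists_subseq_snd_tendsto hY hweak
    (fun n m => hdiam _ (huK _) _ (huK _)) (fun n => hdiam _ (huK _) _ hz)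
    (fun s hs => hφ.tendsto_atTop.eventually (hfar z hz s hs))
  have hχ : Tendsto (fun n => φ (ψ n)) atTop atTop := hφ.tendsto_atTop.comp hψ.tendsto_atTop
  let w : ℕ → X × Y := fun n => u (φ (ψ n))
  have hTw : Tendsto (fun n => hN.seminorm X Y (T (w n) - w n)) atTop (𝓝 0) := hTu.comp hχ
  -- the orbit of `z` under the nonexpansive mappings which almost fix the sequence `w`
  let O : Set (X × Y) := {x | ∃ G : X × Y → X × Y, Set.MapsTo G K K ∧
    (∀ x ∈ K, ∀ y ∈ K, hN.seminorm X Y (G x - G y) ≤ hN.seminorm X Y (x - y)) ∧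
    Tendsto (fun n => hN.seminorm X Y (G (w n) - w n)) atTop (𝓝 0) ∧ G z = x}
  have hOK : O ⊆ K := by
    rintro _ ⟨G, hG, -, -, rfl⟩
    exact hG hz
  have hO2 : ∀ x ∈ O, x.2 = z.2 := by
    rintro _ ⟨G, hG, hGp, hGw, rfl⟩
    exact hN.snd_apply_weak_limit hconv hKc hdiam (fun n => huK _)
      (fun x hx s hs => hχ.eventually (hfar x hx s hs))
      (fun f => (hweak f).comp hψ.tendsto_atTop) hy hG hGp hGw
  have hOne : O.Nonempty := ⟨z, id, Set.mapsTo_id K, fun _ _ _ _ => le_rfl, by simp, rfl⟩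
  have hOconv : Convex ℝ O := by
    rintro _ ⟨G, hG, hGp, hGw, rfl⟩ _ ⟨G', hG', hGp', hGw', rfl⟩ a b ha hb hab
    refine ⟨fun x => a • G x + b • G' x, fun x hx => hconv (hG hx) (hG' hx) ha hb hab,
      fun x hx y hy => ?_, ?_, rfl⟩
    · refine (Seminorm.convex_combination_sub_le _ ha hb _ _ _ _).trans ?_
      have h1 := mul_le_mul_of_nonneg_left (hGp x hx y hy) ha
      have h2 := mul_le_mul_of_nonneg_left (hGp' x hx y hy) hb
      have h3 : a * hN.seminorm X Y (x - y) + b * hN.seminorm X Y (x - y) =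
        hN.seminorm X Y (x - y) := by rw [← add_mul, hab, one_mul]
      linarith
    · have hlim := (hGw.const_mul a).add (hGw'.const_mul b)
      rw [mul_zero, mul_zero, add_zero] at hlim
      refine squeeze_zero (fun n => apply_nonneg _ _) (fun n => ?_) hlim
      have h := Seminorm.convex_combination_sub_le (hN.seminorm X Y) ha hb
        (G (w n)) (G' (w n)) (w n) (w n)
      rwa [← add_smul a b (w n), hab, one_smul] at h
  have hOT : Set.MapsTo T O O := by
    rintro _ ⟨G, hG, hGp, hGw, rfl⟩
    refine ⟨fun x => T (G x), fun x hx => hT (hG hx), fun x hx y hy =>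
      (hTp _ (hG hx) _ (hG hy)).trans (hGp x hx y hy), ?_, rfl⟩
    have hlim := hGw.add hTw
    rw [add_zero] at hlim
    refine squeeze_zero (fun n => apply_nonneg _ _) (fun n => ?_) hlim
    have h := map_add_le_add (hN.seminorm X Y) (T (G (w n)) - T (w n)) (T (w n) - w n)
    rw [sub_add_sub_cancel] at h
    have h' := hTp _ (hG (huK (φ (ψ n)))) _ (huK (φ (ψ n)))
    exact h.trans (add_le_add_left h' _)
  have hclK : closure O ⊆ K := closure_minimal hOK hKc
  have hcl : closure O = K := hmin _ hclK hOne.closure hOconv.closure isClosed_closure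
    (hOT.closure_of_continuousOn ((hN.continuousOn_of_nonexpansive hTp).mono hclK))
  refine ⟨z.2, fun x hx => ?_⟩
  exact closure_minimal (t := {x : X × Y | x.2 = z.2}) hO2
    (isClosed_eq continuous_snd continuous_const) (hcl.ge hx)

end IsStrictMonoNorm

/-- **Theorem (Wiśnicki).** Let `X` and `Y` be real Banach spaces and let `N` be a
monotone, normalized and strictly monotone norm on `ℝ²`.  If `X` has the weak fixed
point property and `Y` has the GGLD property, then the direct sum `X ⊕_N Y`
(that is, `X × Y` with the norm `‖(x,y)‖ = N(‖x‖, ‖y‖)`) has the weak fixed point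
property.

Weak compactness is expressed via the weak topology `WeakSpace ℝ _` (the monotone
normalized norm `N` on the product is equivalent to the standard product norm, so the
weak topologies coincide), and nonexpansiveness on the direct sum is expressed with
respect to the norm `(x, y) ↦ N (‖x‖, ‖y‖)`. -/
theorem wfpp_of_directSum
    (X Y : Type*) [NormedAddCommGroup X] [NormedSpace ℝ X] [CompleteSpace X]
    [NormedAddCommGroup Y] [NormedSpace ℝ Y] [CompleteSpace Y]
    (N : ℝ × ℝ → ℝ)
    -- `N` is a norm on `ℝ²`:
    (hN_eq_zero : ∀ p : ℝ × ℝ, N p = 0 ↔ p = 0)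
    (hN_add : ∀ p q : ℝ × ℝ, N (p + q) ≤ N p + N q)
    (hN_smul : ∀ (t : ℝ) (p : ℝ × ℝ), N (t • p) = |t| * N p)
    -- `N` is monotone:
    (hN_mono : ∀ x₁ y₁ x₂ y₂ : ℝ, 0 ≤ x₁ → x₁ ≤ x₂ → 0 ≤ y₁ → y₁ ≤ y₂ →
      N (x₁, y₁) ≤ N (x₂, y₂))
    -- `N` is normalized:
    (hN_norm₁ : N (1, 0) = 1) (hN_norm₂ : N (0, 1) = 1)
    -- `N` is strictly monotone:
    (hN_smono : ∀ x₁ y₁ x₂ y₂ : ℝ,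
      ((0 ≤ x₁ ∧ x₁ ≤ x₂ ∧ 0 ≤ y₁ ∧ y₁ < y₂) ∨
        (0 ≤ x₁ ∧ x₁ < x₂ ∧ 0 ≤ y₁ ∧ y₁ ≤ y₂)) →
      N (x₁, y₁) < N (x₂, y₂))
    -- `X` has the weak fixed point property:
    (hX : ∀ C : Set X, C.Nonempty → Convex ℝ C → IsCompact (toWeakSpace ℝ X '' C) →
      ∀ T : X → X, Set.MapsTo T C C → (∀ x ∈ C, ∀ y ∈ C, ‖T x - T y‖ ≤ ‖x - y‖) →
        ∃ z ∈ C, T z = z)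
    -- `Y` has the GGLD property:
    (hY : ∀ x : ℕ → Y,
      (∀ f : Y →L[ℝ] ℝ, Tendsto (fun n => f (x n)) atTop (𝓝 0)) →
      Tendsto (fun n => ‖x n‖) atTop (𝓝 1) →
      1 < limsup (fun m => limsup (fun n => ‖x n - x m‖) atTop) atTop) :
    -- Conclusion: `X ⊕_N Y` has the weak fixed point property.
    ∀ C : Set (X × Y), C.Nonempty → Convex ℝ C →
      IsCompact (toWeakSpace ℝ (X × Y) '' C) →
      ∀ T : X × Y → X × Y, Set.MapsTo T C C →
        (∀ w ∈ C, ∀ v ∈ C,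
          N (‖(T w - T v).1‖, ‖(T w - T v).2‖) ≤ N (‖(w - v).1‖, ‖(w - v).2‖)) →
        ∃ z ∈ C, T z = z := by
  have hN : IsStrictMonoNorm N := ⟨hN_add, hN_smul, hN_mono, hN_norm₁, hN_norm₂,
    fun x y₁ y₂ hx hy hlt => hN_smono x y₁ x y₂ (Or.inl ⟨hx, le_rfl, hy, hlt⟩)⟩
  intro C hne hconv hC T hT hTp
  obtain ⟨K, hKC, hKne, hKconv, hK, hTK, hmin⟩ := exists_minimal_invariant hne hconv hC hT
  obtain ⟨y₀, hy₀⟩ := hN.exists_subset_slice hY hKne hKconv hK hTK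
    (fun x hx y hy => hTp x (hKC hx) y (hKC hy)) hmin
  have hslice : ∀ x ∈ Prod.fst '' K, (x, y₀) ∈ K := by
    rintro _ ⟨q, hq, rfl⟩
    rwa [← hy₀ q hq]
  have hcpt : IsCompact (toWeakSpace ℝ X '' (Prod.fst '' K)) := by
    have h := hK.image (WeakSpace.map (ContinuousLinearMap.fst ℝ X Y)).continuous
    rw [Set.image_image] at h ⊢
    exact h
  obtain ⟨x, hx, hfix⟩ := hX (Prod.fst '' K) (hKne.image _)
    (hKconv.linear_image (LinearMap.fst ℝ X Y)) hcpt (fun x => (T (x, y₀)).1)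
    (fun x hx => ⟨_, hTK (hslice x hx), rfl⟩)
    (fun x hx x' hx' => by
      have h := hTp _ (hKC (hslice x hx)) _ (hKC (hslice x' hx'))
      rw [show ((x, y₀) - (x', y₀) : X × Y) = (x - x', 0) by simp, norm_zero, hN.fst_eq,
        abs_norm] at h
      exact (hN.norm_fst_le _).trans h)
  exact ⟨(x, y₀), hKC (hslice x hx), Prod.ext hfix (hy₀ _ (hTK (hslice x hx)))⟩
end

section
/- Let X ⊕_N Y be the direct sum of real Banach spaces X and Y with respect to a monotone, normalized and strictly monotone norm N on ℝ², and assume Y has the GGLD property. Suppose the vectors w_n = (x_n, y_n) ∈ X ⊕_N Y converge weakly to 0, the limit L = lim_{n→∞} ‖w_n‖ exists, and the double limit of ‖w_n − w_m‖ as n, m → ∞ with n ≠ m exists and equals L. Then lim_{n→∞} ‖y_n‖ = 0. -/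
open Filter Topology

/-- In a real normed space, a weakly null sequence `x` satisfies `‖v‖ ≤ liminf ‖x n - v‖`. -/
theorem eventually_norm_lt_norm_sub_add_of_weakly_null {E : Type*} [NormedAddCommGroup E]
    [NormedSpace ℝ E] {x : ℕ → E}
    (hx : ∀ f : E →L[ℝ] ℝ, Tendsto (fun n => f (x n)) atTop (𝓝 0)) (v : E) {δ : ℝ}
    (hδ : 0 < δ) : ∀ᶠ n in atTop, ‖v‖ < ‖x n - v‖ + δ := by
  obtain ⟨f, hf, hfv⟩ := exists_dual_vector'' ℝ v
  have hfv' : f v = ‖v‖ := by simpa using hfv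
  filter_upwards [(hx f).eventually (gt_mem_nhds hδ)] with n hn
  have h : |f (x n - v)| ≤ ‖x n - v‖ := by
    simpa using f.le_of_opNorm_le hf (x n - v)
  rw [map_sub, hfv'] at h
  linarith [neg_le_abs (f (x n) - ‖v‖)]

/-- If an iterated limit superior of a nonnegative double sequence exceeds `c`, then the terms
exceed `c` frequently in the iterated sense. -/
theorem frequently_frequently_lt_of_lt_limsup_limsup {g : ℕ → ℕ → ℝ} (hg : ∀ m n, 0 ≤ g m n)
    {c : ℝ} (hc : c < limsup (fun m => limsup (g m) atTop) atTop) :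
    ∃ᶠ m in atTop, ∃ᶠ n in atTop, c < g m n := by
  have hpos : ∀ m, 0 ≤ limsup (g m) atTop := by
    intro m
    rw [limsup_eq]
    refine Real.sInf_nonneg fun a ha => ?_
    obtain ⟨n, hn⟩ := ha.exists
    exact (hg m n).trans hn
  have hcob : ∀ u : ℕ → ℝ, (∀ n, 0 ≤ u n) → IsCoboundedUnder (· ≤ ·) atTop u := fun u hu =>
    (isBoundedUnder_of ⟨0, hu⟩ : IsBoundedUnder (· ≥ ·) atTop u).isCoboundedUnder_le
  exact (frequently_lt_of_lt_limsup (hcob _ hpos) hc).mono fun m hm =>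
    frequently_lt_of_lt_limsup (hcob _ (hg m)) hm

/-- **Lemma 4.2 (cf. [PrWi, Lemma 4]).** Let `X ⊕_N Y` be the direct sum of real Banach
spaces `X` and `Y` with respect to a monotone, normalized and strictly monotone norm `N`
on `ℝ²`, and assume `Y` has the GGLD property.  Suppose the vectors
`w n = (x n, y n) ∈ X ⊕_N Y` converge weakly to `0`, the limit `L = lim ‖w n‖_N` exists,
and the double limit of `‖w n - w m‖_N` as `n, m → ∞`, `n ≠ m`, exists and equals `L`.
Then `lim ‖y n‖ = 0`. -/
theorem norm_snd_tendsto_zero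
    (X Y : Type*) [NormedAddCommGroup X] [NormedSpace ℝ X] [CompleteSpace X]
    [NormedAddCommGroup Y] [NormedSpace ℝ Y] [CompleteSpace Y]
    (N : ℝ × ℝ → ℝ)
    -- `N` is a norm on `ℝ²`:
    (hN_eq_zero : ∀ p : ℝ × ℝ, N p = 0 ↔ p = 0)
    (hN_add : ∀ p q : ℝ × ℝ, N (p + q) ≤ N p + N q)
    (hN_smul : ∀ (t : ℝ) (p : ℝ × ℝ), N (t • p) = |t| * N p)
    -- `N` is monotone:
    (hN_mono : ∀ x₁ y₁ x₂ y₂ : ℝ, 0 ≤ x₁ → x₁ ≤ x₂ → 0 ≤ y₁ → y₁ ≤ y₂ →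
      N (x₁, y₁) ≤ N (x₂, y₂))
    -- `N` is normalized:
    (hN_norm₁ : N (1, 0) = 1) (hN_norm₂ : N (0, 1) = 1)
    -- `N` is strictly monotone:
    (hN_smono : ∀ x₁ y₁ x₂ y₂ : ℝ,
      ((0 ≤ x₁ ∧ x₁ ≤ x₂ ∧ 0 ≤ y₁ ∧ y₁ < y₂) ∨
        (0 ≤ x₁ ∧ x₁ < x₂ ∧ 0 ≤ y₁ ∧ y₁ ≤ y₂)) →
      N (x₁, y₁) < N (x₂, y₂))
    -- `Y` has the GGLD property:
    (hY : ∀ x : ℕ → Y,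
      (∀ f : Y →L[ℝ] ℝ, Tendsto (fun n => f (x n)) atTop (𝓝 0)) →
      Tendsto (fun n => ‖x n‖) atTop (𝓝 1) →
      1 < limsup (fun m => limsup (fun n => ‖x n - x m‖) atTop) atTop)
    (w : ℕ → X × Y) (L : ℝ)
    -- `(w n)` converges weakly to `0`:
    (hweak : ∀ f : (X × Y) →L[ℝ] ℝ, Tendsto (fun n => f (w n)) atTop (𝓝 0))
    -- `lim ‖w n‖_N = L`:
    (hlim : Tendsto (fun n => N (‖(w n).1‖, ‖(w n).2‖)) atTop (𝓝 L))
    -- the double limit `lim_{n,m → ∞, n ≠ m} ‖w n - w m‖_N` exists and equals `L`: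
    (hdouble : ∀ ε > (0 : ℝ), ∃ K : ℕ, ∀ n ≥ K, ∀ m ≥ K, n ≠ m →
      |N (‖(w n).1 - (w m).1‖, ‖(w n).2 - (w m).2‖) - L| < ε) :
    Tendsto (fun n => ‖(w n).2‖) atTop (𝓝 0) := by
  have hN_fst : ∀ s : ℝ, N (s, 0) = |s| := fun s => by
    simpa [hN_norm₁] using hN_smul s (1, 0)
  have hN_snd : ∀ t : ℝ, N (0, t) = |t| := fun t => by
    simpa [hN_norm₂] using hN_smul t (0, 1)
  have hN_le : ∀ s t s' t' : ℝ, N (s, t) ≤ N (s', t') + |s - s'| + |t - t'| := by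
    intro s t s' t'
    have h₁ := hN_add ((s', t') + (s - s', 0)) (0, t - t')
    have h₂ := hN_add (s', t') (s - s', 0)
    rw [hN_snd] at h₁
    rw [hN_fst] at h₂
    have he : ((s', t') + (s - s', 0) + (0, t - t') : ℝ × ℝ) = (s, t) := by
      ext <;> simp
    rw [he] at h₁
    linarith
  by_contra hcon
  obtain ⟨ε, hε, hfreq⟩ : ∃ ε > 0, ∃ᶠ n in atTop, ε ≤ ‖(w n).2‖ := by
    rw [Metric.tendsto_nhds] at hcon
    push Not at hcon
    obtain ⟨ε, hε, h⟩ := hcon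
    exact ⟨ε, hε, h.mono fun n hn => by simpa using hn⟩
  obtain ⟨φ, hφ, hφε⟩ := extraction_of_frequently_atTop hfreq
  obtain ⟨B, hB⟩ := hlim.bddAbove_range
  have hB' : ∀ n, N (‖(w n).1‖, ‖(w n).2‖) ≤ B := fun n => hB ⟨n, rfl⟩
  have hmem : ∀ k, (‖(w (φ k)).1‖, ‖(w (φ k)).2‖) ∈ Set.Icc (0 : ℝ) B ×ˢ Set.Icc (0 : ℝ) B := by
    intro k
    have h₁ := hN_mono _ 0 _ _ (norm_nonneg (w (φ k)).1) le_rfl le_rfl (norm_nonneg (w (φ k)).2)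
    have h₂ := hN_mono 0 _ _ _ le_rfl (norm_nonneg (w (φ k)).1) (norm_nonneg (w (φ k)).2) le_rfl
    rw [hN_fst, abs_norm] at h₁
    rw [hN_snd, abs_norm] at h₂
    exact ⟨⟨norm_nonneg _, h₁.trans (hB' _)⟩, ⟨norm_nonneg _, h₂.trans (hB' _)⟩⟩
  obtain ⟨⟨a, b⟩, -, ψ, hψ, hab⟩ := (isCompact_Icc.prod isCompact_Icc).tendsto_subseq hmem
  set θ : ℕ → ℕ := φ ∘ ψ with hθ_def
  have hθ : StrictMono θ := hφ.comp hψ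
  have ha : Tendsto (fun k => ‖(w (θ k)).1‖) atTop (𝓝 a) := hab.fst_nhds
  have hb : Tendsto (fun k => ‖(w (θ k)).2‖) atTop (𝓝 b) := hab.snd_nhds
  have ha0 : 0 ≤ a := ge_of_tendsto' ha fun k => norm_nonneg _
  have hb0 : 0 < b := hε.trans_le (ge_of_tendsto' hb fun k => hφε _)
  have hL : L ≤ N (a, b) := by
    have hr : Tendsto (fun k => N (a, b) + |‖(w (θ k)).1‖ - a| + |‖(w (θ k)).2‖ - b|)
        atTop (𝓝 (N (a, b) + |a - a| + |b - b|)) :=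
      ((ha.sub_const a).abs.const_add _).add (hb.sub_const b).abs
    simp only [sub_self, abs_zero, add_zero] at hr
    exact le_of_tendsto_of_tendsto' (hlim.comp hθ.tendsto_atTop) hr fun k => hN_le _ _ _ _
  have hx : ∀ f : X →L[ℝ] ℝ, Tendsto (fun k => f (w (θ k)).1) atTop (𝓝 0) := fun f =>
    (hweak (f.comp (ContinuousLinearMap.fst ℝ X Y))).comp hθ.tendsto_atTop
  have hz : ∀ f : Y →L[ℝ] ℝ, Tendsto (fun k => f (b⁻¹ • (w (θ k)).2)) atTop (𝓝 0) := fun f => by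
    simpa using ((hweak (f.comp (ContinuousLinearMap.snd ℝ X Y))).comp
      hθ.tendsto_atTop).const_mul b⁻¹
  have hz1 : Tendsto (fun k => ‖b⁻¹ • (w (θ k)).2‖) atTop (𝓝 1) := by
    simpa [norm_smul, abs_of_pos hb0, hb0.ne'] using hb.const_mul b⁻¹
  obtain ⟨c, hc1, hc⟩ := exists_between (hY _ hz hz1)
  have hfr := frequently_frequently_lt_of_lt_limsup_limsup
    (g := fun m n => ‖b⁻¹ • (w (θ n)).2 - b⁻¹ • (w (θ m)).2‖) (fun _ _ => norm_nonneg _) hc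
  have hgap : N (a, b) < N (a, c * b) :=
    hN_smono _ _ _ _ (Or.inl ⟨ha0, le_rfl, hb0.le, by nlinarith⟩)
  obtain ⟨δ, hδ, hδgap⟩ : ∃ δ > 0, 3 * δ = N (a, c * b) - N (a, b) :=
    ⟨(N (a, c * b) - N (a, b)) / 3, by linarith, by ring⟩
  obtain ⟨K, hK⟩ := hdouble δ hδ
  obtain ⟨m, hm, hma, hmK⟩ := (hfr.and_eventually
    ((ha.eventually (lt_mem_nhds (sub_lt_self a hδ))).and (eventually_ge_atTop K))).exists
  obtain ⟨n, hn, hnx, hnm⟩ := (hm.and_eventually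
    ((eventually_norm_lt_norm_sub_add_of_weakly_null hx (w (θ m)).1 hδ).and
      (eventually_gt_atTop m))).exists
  have hclose := hK (θ n) ((hmK.trans hnm.le).trans (hθ.id_le n)) (θ m)
    (hmK.trans (hθ.id_le m)) (hθ.injective.ne hnm.ne')
  have hy : c * b ≤ ‖(w (θ n)).2 - (w (θ m)).2‖ := by
    rw [← smul_sub, norm_smul, norm_inv, Real.norm_of_nonneg hb0.le, inv_mul_eq_div,
      lt_div_iff₀ hb0] at hn
    exact hn.le
  have hmono := hN_mono a (c * b) (‖(w (θ n)).1 - (w (θ m)).1‖ + 2 * δ) _ ha0 (by linarith)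
    (by positivity) hy
  have hshift := hN_le (‖(w (θ n)).1 - (w (θ m)).1‖ + 2 * δ) ‖(w (θ n)).2 - (w (θ m)).2‖
    ‖(w (θ n)).1 - (w (θ m)).1‖ ‖(w (θ n)).2 - (w (θ m)).2‖
  rw [add_sub_cancel_left, sub_self, abs_zero, abs_of_pos (by positivity)] at hshift
  linarith [(abs_lt.1 hclose).2]
end

section
/- Let Ψ be the set of all continuous convex functions ψ : [0,1] → ℝ with ψ(0) = ψ(1) = 1 and max{1−t, t} ≤ ψ(t) ≤ 1 for all t ∈ [0,1], and for ψ ∈ Ψ let ‖(x₁,x₂)‖_ψ = (|x₁| + |x₂|)·ψ(|x₂|/(|x₁| + |x₂|)) for (x₁,x₂) ≠ (0,0), ‖(0,0)‖_ψ = 0. Then the norm ‖·‖_ψ on ℝ² is strictly monotone if and only if ψ(t) > max{1−t, t} for all 0 < t < 1. -/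
/-- `ψ` belongs to the class `Ψ`: it is continuous and convex on `[0,1]`, satisfies
`ψ 0 = ψ 1 = 1` and `max (1-t) t ≤ ψ t ≤ 1` for all `t ∈ [0,1]`. -/
def MemPsi (ψ : ℝ → ℝ) : Prop :=
  ContinuousOn ψ (Set.Icc 0 1) ∧ ConvexOn ℝ (Set.Icc 0 1) ψ ∧
    ψ 0 = 1 ∧ ψ 1 = 1 ∧ ∀ t ∈ Set.Icc (0 : ℝ) 1, max (1 - t) t ≤ ψ t ∧ ψ t ≤ 1

/-- The function `‖(x₁,x₂)‖_ψ = (|x₁| + |x₂|) · ψ(|x₂| / (|x₁| + |x₂|))` for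
`(x₁,x₂) ≠ (0,0)`, and `‖(0,0)‖_ψ = 0`. -/
noncomputable def normPsi (ψ : ℝ → ℝ) (p : ℝ × ℝ) : ℝ :=
  if p = 0 then 0 else (|p.1| + |p.2|) * ψ (|p.2| / (|p.1| + |p.2|))

theorem normPsi_of_nonneg (ψ : ℝ → ℝ) {x y : ℝ} (hx : 0 ≤ x) (hy : 0 ≤ y) :
    normPsi ψ (x, y) = (x + y) * ψ (y / (x + y)) := by
  by_cases h : x = 0 ∧ y = 0
  · simp [normPsi, h.1, h.2]
  · simp [normPsi, h, abs_of_nonneg hx, abs_of_nonneg hy]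

theorem normPsi_swap (ψ : ℝ → ℝ) {x y : ℝ} (hx : 0 ≤ x) (hy : 0 ≤ y) :
    normPsi (fun t => ψ (1 - t)) (y, x) = normPsi ψ (x, y) := by
  rw [normPsi_of_nonneg _ hy hx, normPsi_of_nonneg _ hx hy, add_comm y x]
  rcases (add_nonneg hx hy).eq_or_lt with h | h
  · simp [← h]
  · have h' : 1 - x / (x + y) = y / (x + y) := by field_simp; ring
    simp only [h']

theorem normPsi_fst_zero {ψ : ℝ → ℝ} (h1 : ψ 1 = 1) {y : ℝ} (hy : 0 ≤ y) :
    normPsi ψ (0, y) = y := by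
  rw [normPsi_of_nonneg ψ le_rfl hy]
  rcases hy.eq_or_lt with rfl | hy
  · simp
  · simp [div_self hy.ne', h1]

theorem normPsi_snd_zero {ψ : ℝ → ℝ} (h0 : ψ 0 = 1) {x : ℝ} (hx : 0 ≤ x) :
    normPsi ψ (x, 0) = x := by
  simp [normPsi_of_nonneg ψ hx le_rfl, h0]

theorem normPsi_lt_of_snd_lt {ψ : ℝ → ℝ} (hψ : ConvexOn ℝ (Set.Icc 0 1) ψ)
    (h0 : ψ 0 = 1) (h1 : ψ 1 = 1) (h : ∀ t, 0 < t → t < 1 → 1 - t < ψ t)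
    {x y z : ℝ} (hx : 0 ≤ x) (hy : 0 ≤ y) (hyz : y < z) :
    normPsi ψ (x, y) < normPsi ψ (x, z) := by
  have hz : 0 < z := hy.trans_lt hyz
  rcases hx.eq_or_lt with rfl | hx
  · rwa [normPsi_fst_zero h1 hy, normPsi_fst_zero h1 hz.le]
  rw [normPsi_of_nonneg ψ hx.le hy, normPsi_of_nonneg ψ hx.le hz.le]
  have hxy : 0 < x + y := by positivity
  have hxz : 0 < x + z := by positivity
  have hlt : x < (x + z) * ψ (z / (x + z)) := by
    have hs := h (z / (x + z)) (by positivity) ((div_lt_one hxz).2 (by linarith))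
    calc x = (x + z) * (1 - z / (x + z)) := by field_simp; ring
      _ < _ := mul_lt_mul_of_pos_left hs hxz
  have hr : 0 ≤ y * (x + z) / (z * (x + y)) := by positivity
  have hr' : y * (x + z) / (z * (x + y)) ≤ 1 :=
    (div_le_one (by positivity)).2 (by nlinarith)
  have hconv := hψ.2 (Set.left_mem_Icc.2 zero_le_one)
    (⟨by positivity, (div_le_one hxz).2 (by linarith)⟩ : z / (x + z) ∈ Set.Icc (0 : ℝ) 1)
    (sub_nonneg.2 hr') hr (sub_add_cancel _ _)
  have harg : y * (x + z) / (z * (x + y)) * (z / (x + z)) = y / (x + y) := by field_simp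
  simp only [smul_eq_mul, mul_zero, zero_add, h0, mul_one, harg] at hconv
  calc (x + y) * ψ (y / (x + y))
      ≤ (x + y) * (1 - y * (x + z) / (z * (x + y)) +
          y * (x + z) / (z * (x + y)) * ψ (z / (x + z))) :=
        mul_le_mul_of_nonneg_left hconv hxy.le
    _ = (1 - y / z) * x + y / z * ((x + z) * ψ (z / (x + z))) := by field_simp; ring
    _ < (1 - y / z) * ((x + z) * ψ (z / (x + z))) +
          y / z * ((x + z) * ψ (z / (x + z))) := by
        have : 0 < 1 - y / z := sub_pos.2 ((div_lt_one hz).2 hyz)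
        gcongr
    _ = (x + z) * ψ (z / (x + z)) := by ring

theorem normPsi_lt_of_fst_lt {ψ : ℝ → ℝ} (hψ : ConvexOn ℝ (Set.Icc 0 1) ψ)
    (h0 : ψ 0 = 1) (h1 : ψ 1 = 1) (h : ∀ t, 0 < t → t < 1 → t < ψ t)
    {x z y : ℝ} (hx : 0 ≤ x) (hxz : x < z) (hy : 0 ≤ y) :
    normPsi ψ (x, y) < normPsi ψ (z, y) := by
  have hconv : ConvexOn ℝ (Set.Icc 0 1) (fun t => ψ (1 - t)) := by
    refine ⟨convex_Icc 0 1, fun s hs t ht a b ha hb hab => ?_⟩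
    have hst := hψ.2 (Set.Icc.mem_iff_one_sub_mem.1 hs) (Set.Icc.mem_iff_one_sub_mem.1 ht) ha hb hab
    have harg : a • (1 - s) + b • (1 - t) = 1 - (a • s + b • t) := by
      simp only [smul_eq_mul]; linear_combination hab
    rwa [harg] at hst
  rw [← normPsi_swap ψ hx hy, ← normPsi_swap ψ (hx.trans hxz.le) hy]
  exact normPsi_lt_of_snd_lt hconv (by simpa using h1) (by simpa using h0)
    (fun t ht0 ht1 => h (1 - t) (by linarith) (by linarith)) hy hx hxz

/-- **[TaKaSa2, Corollary 3].**  For `ψ ∈ Ψ`, the norm `‖·‖_ψ` on `ℝ²` is strictly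
monotone if and only if `ψ t > max (1-t) t` for all `0 < t < 1`. -/
theorem normPsi_strictlyMonotone_iff (ψ : ℝ → ℝ) (hψ : MemPsi ψ) :
    (∀ x₁ y₁ x₂ y₂ : ℝ,
      ((0 ≤ x₁ ∧ x₁ ≤ x₂ ∧ 0 ≤ y₁ ∧ y₁ < y₂) ∨
        (0 ≤ x₁ ∧ x₁ < x₂ ∧ 0 ≤ y₁ ∧ y₁ ≤ y₂)) →
      normPsi ψ (x₁, y₁) < normPsi ψ (x₂, y₂))
    ↔ ∀ t : ℝ, 0 < t → t < 1 → max (1 - t) t < ψ t := by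
  obtain ⟨-, hconv, h0, h1, -⟩ := hψ
  constructor
  · intro h t ht0 ht1
    have ht : normPsi ψ (1 - t, t) = ψ t := by
      simp [normPsi_of_nonneg ψ (sub_nonneg.2 ht1.le) ht0.le]
    have hfst := h (1 - t) 0 (1 - t) t (.inl ⟨by linarith, le_rfl, le_rfl, ht0⟩)
    have hsnd := h 0 t (1 - t) t (.inr ⟨le_rfl, by linarith, ht0.le, le_rfl⟩)
    rw [normPsi_snd_zero h0 (by linarith), ht] at hfst
    rw [normPsi_fst_zero h1 ht0.le, ht] at hsnd
    exact max_lt hfst hsnd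
  · intro h x₁ y₁ x₂ y₂ hle
    have hfst {x z y : ℝ} (hx : 0 ≤ x) (hxz : x < z) (hy : 0 ≤ y) :
        normPsi ψ (x, y) < normPsi ψ (z, y) :=
      normPsi_lt_of_fst_lt hconv h0 h1
        (fun t ht0 ht1 => (le_max_right _ _).trans_lt (h t ht0 ht1)) hx hxz hy
    have hsnd {x y z : ℝ} (hx : 0 ≤ x) (hy : 0 ≤ y) (hyz : y < z) :
        normPsi ψ (x, y) < normPsi ψ (x, z) :=
      normPsi_lt_of_snd_lt hconv h0 h1
        (fun t ht0 ht1 => (le_max_left _ _).trans_lt (h t ht0 ht1)) hx hy hyz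
    rcases hle with ⟨hx, hxx, hy, hyy⟩ | ⟨hx, hxx, hy, hyy⟩
    · rcases hxx.eq_or_lt with rfl | hlt
      · exact hsnd hx hy hyy
      · exact (hfst hx hlt hy).trans (hsnd (hx.trans hxx) hy hyy)
    · rcases hyy.eq_or_lt with rfl | hlt
      · exact hfst hx hxx hy
      · exact (hfst hx hxx hy).trans (hsnd (hx.trans hxx.le) hy hlt)
end

section
/- Let N be a monotone norm on ℝ². If N is strictly monotone, then N is uniformly monotone in the following sense: for every ε > 0 there exists δ > 0 such that whenever a, b, c ≥ 0 satisfy N(a,b) ≤ 1, N(a,c) ≤ 1 and N(a,b) < N(a,c) + δ, then b < c + ε. -/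
/-- A subadditive, absolutely homogeneous function on `ℝ²` is continuous. -/
theorem continuous_of_subadditive_of_homogeneous (N : ℝ × ℝ → ℝ)
    (hN_add : ∀ p q : ℝ × ℝ, N (p + q) ≤ N p + N q)
    (hN_smul : ∀ (t : ℝ) (p : ℝ × ℝ), N (t • p) = |t| * N p)
    (h₁ : 0 ≤ N (1, 0)) (h₂ : 0 ≤ N (0, 1)) : Continuous N := by
  refine (LipschitzWith.of_le_add_mul (f := N) (N (1, 0) + N (0, 1)).toNNReal
    fun p q => ?_).continuous
  have hpq : p = q + ((p.1 - q.1) • ((1, 0) : ℝ × ℝ) + (p.2 - q.2) • ((0, 1) : ℝ × ℝ)) := by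
    ext <;> simp
  have hle := hN_add q ((p.1 - q.1) • ((1, 0) : ℝ × ℝ) + (p.2 - q.2) • ((0, 1) : ℝ × ℝ))
  have hle' := hN_add ((p.1 - q.1) • ((1, 0) : ℝ × ℝ)) ((p.2 - q.2) • ((0, 1) : ℝ × ℝ))
  rw [← hpq] at hle
  rw [hN_smul, hN_smul] at hle'
  have hd₁ : |p.1 - q.1| ≤ dist p q := le_max_left _ _
  have hd₂ : |p.2 - q.2| ≤ dist p q := le_max_right _ _
  rw [Real.coe_toNNReal _ (add_nonneg h₁ h₂)]
  linarith [mul_le_mul_of_nonneg_right hd₁ h₁, mul_le_mul_of_nonneg_right hd₂ h₂]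

/-- A strictly monotone norm on `ℝ²` is uniformly monotone: for every `ε > 0` there
exists `δ > 0` such that whenever `a, b, c ≥ 0` satisfy `N(a,b) ≤ 1`, `N(a,c) ≤ 1` and
`N(a,b) < N(a,c) + δ`, then `b < c + ε`. -/
theorem uniformly_monotone_of_strictly_monotone
    (N : ℝ × ℝ → ℝ)
    -- `N` is a norm on `ℝ²`:
    (hN_eq_zero : ∀ p : ℝ × ℝ, N p = 0 ↔ p = 0)
    (hN_add : ∀ p q : ℝ × ℝ, N (p + q) ≤ N p + N q)
    (hN_smul : ∀ (t : ℝ) (p : ℝ × ℝ), N (t • p) = |t| * N p)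
    -- `N` is monotone:
    (hN_mono : ∀ x₁ y₁ x₂ y₂ : ℝ, 0 ≤ x₁ → x₁ ≤ x₂ → 0 ≤ y₁ → y₁ ≤ y₂ →
      N (x₁, y₁) ≤ N (x₂, y₂))
    -- `N` is strictly monotone:
    (hN_smono : ∀ x₁ y₁ x₂ y₂ : ℝ,
      ((0 ≤ x₁ ∧ x₁ ≤ x₂ ∧ 0 ≤ y₁ ∧ y₁ < y₂) ∨
        (0 ≤ x₁ ∧ x₁ < x₂ ∧ 0 ≤ y₁ ∧ y₁ ≤ y₂)) →
      N (x₁, y₁) < N (x₂, y₂)) :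
    ∀ ε > (0 : ℝ), ∃ δ > (0 : ℝ), ∀ a b c : ℝ, 0 ≤ a → 0 ≤ b → 0 ≤ c →
      N (a, b) ≤ 1 → N (a, c) ≤ 1 → N (a, b) < N (a, c) + δ → b < c + ε := by
  intro ε hε
  have h_zero : N (0, 0) = 0 := (hN_eq_zero _).2 rfl
  have h₁ : 0 < N (1, 0) := h_zero.symm.trans_lt (hN_smono 0 0 1 0 (by norm_num))
  have h₂ : 0 < N (0, 1) := h_zero.symm.trans_lt (hN_smono 0 0 0 1 (by norm_num))
  have hcont := continuous_of_subadditive_of_homogeneous N hN_add hN_smul h₁.le h₂.le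
  have hf : Continuous fun p : ℝ × ℝ => N (p.1, p.2 + ε) - N (p.1, p.2) := by fun_prop
  have hne : (Set.Icc (0 : ℝ × ℝ) (1 / N (1, 0), 1 / N (0, 1))).Nonempty :=
    Set.nonempty_Icc.2 ⟨by simpa using h₁.le, by simpa using h₂.le⟩
  obtain ⟨p, hp, hmin⟩ := isCompact_Icc.exists_isMinOn hne hf.continuousOn
  refine ⟨N (p.1, p.2 + ε) - N (p.1, p.2), sub_pos.2 (hN_smono _ _ _ _
    (Or.inl ⟨hp.1.1, le_rfl, hp.1.2, by linarith⟩)), ?_⟩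
  intro a b c ha hb hc _ hac hlt
  by_contra! hbc
  have ha_le : a ≤ 1 / N (1, 0) := by
    have h := hN_smul a (1, 0)
    simp only [Prod.smul_mk, smul_eq_mul, mul_one, mul_zero, abs_of_nonneg ha] at h
    rw [le_div_iff₀ h₁, ← h]
    exact (hN_mono a 0 a c ha le_rfl le_rfl hc).trans hac
  have hc_le : c ≤ 1 / N (0, 1) := by
    have h := hN_smul c (0, 1)
    simp only [Prod.smul_mk, smul_eq_mul, mul_one, mul_zero, abs_of_nonneg hc] at h
    rw [le_div_iff₀ h₂, ← h]
    exact (hN_mono 0 c a c le_rfl ha hc le_rfl).trans hac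
  have hδ : N (p.1, p.2 + ε) - N (p.1, p.2) ≤ N (a, c + ε) - N (a, c) :=
    hmin (show (a, c) ∈ Set.Icc _ _ from ⟨⟨ha, hc⟩, ⟨ha_le, hc_le⟩⟩)
  linarith [hN_mono a (c + ε) a b ha le_rfl (by linarith) hbc]
end

section
/- Let C be a nonempty bounded closed convex subset of a real Banach space X and let T : C → C be nonexpansive. Then inf_{x ∈ C} ‖T x − x‖ = 0; in particular there exists a sequence (w_n) in C with lim_{n→∞} ‖T w_n − w_n‖ = 0 (an approximate fixed point sequence for T). -/
open Filter Topology

/-- A nonexpansive self-map of a nonempty bounded convex set has `ε`-fixed points: iterate the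
contraction `x ↦ s • p + (1 - s) • T x` for small `s`. -/
lemma exists_norm_map_sub_lt_of_nonexpansive
    {X : Type*} [SeminormedAddCommGroup X] [NormedSpace ℝ X] {C : Set X}
    (hne : C.Nonempty) (hbdd : Bornology.IsBounded C) (hconv : Convex ℝ C)
    {T : X → X} (hT : Set.MapsTo T C C)
    (hTne : ∀ x ∈ C, ∀ y ∈ C, ‖T x - T y‖ ≤ ‖x - y‖) {ε : ℝ} (hε : 0 < ε) :
    ∃ x ∈ C, ‖T x - x‖ < ε := by
  obtain ⟨p, hp⟩ := hne
  obtain ⟨D, hD⟩ := Metric.isBounded_iff.1 hbdd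
  have hDnorm : ∀ x ∈ C, ∀ y ∈ C, ‖x - y‖ ≤ D := fun x hx y hy => by
    simpa [dist_eq_norm] using hD hx hy
  have hD0 : 0 ≤ D := (norm_nonneg _).trans (hDnorm p hp p hp)
  obtain ⟨s, hs0, hs1, hsD⟩ : ∃ s : ℝ, 0 < s ∧ s ≤ 1 ∧ s * D < ε / 2 := by
    have hpos : 0 < 2 * D + ε := by positivity
    refine ⟨ε / (2 * D + ε), by positivity, (div_le_one hpos).2 (by linarith), ?_⟩
    rw [div_mul_eq_mul_div, div_lt_iff₀ hpos]
    nlinarith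
  have hs : 0 ≤ 1 - s := sub_nonneg.2 hs1
  set S : X → X := fun x => s • p + (1 - s) • T x with hS
  have hSC : Set.MapsTo S C C := fun x hx => hconv hp (hT hx) hs0.le hs (by ring)
  have hiter (n : ℕ) : S^[n] p ∈ C := hSC.iterate n hp
  have hdecay (n : ℕ) : ‖S (S^[n] p) - S^[n] p‖ ≤ (1 - s) ^ n * D := by
    induction n with
    | zero => simpa using hDnorm _ (hSC hp) _ hp
    | succ n ih =>
      rw [Function.iterate_succ_apply']
      set x := S^[n] p
      have hx : x ∈ C := hiter n
      calc ‖S (S x) - S x‖ = ‖(1 - s) • (T (S x) - T x)‖ := by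
            congr 1
            simp only [hS]
            module
        _ = (1 - s) * ‖T (S x) - T x‖ := by rw [norm_smul, Real.norm_of_nonneg hs]
        _ ≤ (1 - s) * ((1 - s) ^ n * D) := by
            gcongr
            exact (hTne _ (hSC hx) _ hx).trans ih
        _ = (1 - s) ^ (n + 1) * D := by ring
  have hlim : Tendsto (fun n : ℕ => (1 - s) ^ n * D) atTop (𝓝 0) := by
    simpa using (tendsto_pow_atTop_nhds_zero_of_lt_one hs (by linarith)).mul_const D
  obtain ⟨n, hn⟩ := (hlim.eventually_lt_const (half_pos hε)).exists
  refine ⟨S^[n] p, hiter n, ?_⟩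
  have hdec := hdecay n
  set x := S^[n] p
  have hTS : ‖T x - S x‖ ≤ s * D := by
    have heq : T x - S x = s • (T x - p) := by
      simp only [hS]
      module
    rw [heq, norm_smul, Real.norm_of_nonneg hs0.le]
    gcongr
    exact hDnorm _ (hT (hiter n)) _ hp
  linarith [norm_sub_le_norm_sub_add_norm_sub (T x) (S x) x]

/-- Let `C` be a nonempty bounded closed convex subset of a real Banach space `X` and
`T : C → C` nonexpansive.  Then `inf_{x ∈ C} ‖T x - x‖ = 0`; in particular there is an
approximate fixed point sequence `(w n)` in `C`, i.e. `‖T (w n) - w n‖ → 0`. -/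
theorem approximate_fixed_point_sequence
    (X : Type*) [NormedAddCommGroup X] [NormedSpace ℝ X] [CompleteSpace X]
    (C : Set X) (hCne : C.Nonempty) (hCbdd : Bornology.IsBounded C)
    (hCcl : IsClosed C) (hCconv : Convex ℝ C)
    (T : X → X) (hT : Set.MapsTo T C C)
    (hTne : ∀ x ∈ C, ∀ y ∈ C, ‖T x - T y‖ ≤ ‖x - y‖) :
    sInf ((fun x => ‖T x - x‖) '' C) = 0 ∧
    ∃ w : ℕ → X, (∀ n, w n ∈ C) ∧
      Tendsto (fun n => ‖T (w n) - w n‖) atTop (𝓝 0) := by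
  have happrox : ∀ ε > 0, ∃ x ∈ C, ‖T x - x‖ < ε := fun ε hε =>
    exists_norm_map_sub_lt_of_nonexpansive hCne hCbdd hCconv hT hTne hε
  constructor
  · refine csInf_eq_of_forall_ge_of_forall_gt_exists_lt (hCne.image _) ?_ ?_
    · rintro _ ⟨x, -, rfl⟩
      exact norm_nonneg _
    · intro ε hε
      obtain ⟨x, hx, hlt⟩ := happrox ε hε
      exact ⟨_, ⟨x, hx, rfl⟩, hlt⟩
  · choose w hwC hw using fun n : ℕ => happrox (1 / ((n : ℝ) + 1)) Nat.one_div_pos_of_nat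
    exact ⟨w, hwC, squeeze_zero (fun _ => norm_nonneg _) (fun n => (hw n).le)
      tendsto_one_div_add_atTop_nhds_zero_nat⟩
end

section
/- Let X be a uniformly convex real Banach space, let C be a nonempty bounded closed convex subset of X, and let T : C → C be nonexpansive. Then T has a fixed point in C. -/
open Filter Topology

/-- In a uniformly convex space, two points of a convex set `C` which are both almost asymptotic
centers of `x` relative to `C` are close to each other. -/
theorem exists_forall_eventually_norm_sub_le_norm_sub_lt
    {X : Type*} [NormedAddCommGroup X] [NormedSpace ℝ X] [UniformConvexSpace X]
    {ι : Type*} {l : Filter ι} [l.NeBot] {C : Set X} (hC : Convex ℝ C) (x : ι → X)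
    {ρ : ℝ} (hρ : 0 ≤ ρ)
    (hlow : ∀ z ∈ C, ∀ r, (∀ᶠ n in l, ‖x n - z‖ ≤ r) → ρ ≤ r) {ε : ℝ} (hε : 0 < ε) :
    ∃ η, 0 < η ∧ ∀ y ∈ C, ∀ z ∈ C, (∀ᶠ n in l, ‖x n - y‖ ≤ ρ + η) →
      (∀ᶠ n in l, ‖x n - z‖ ≤ ρ + η) → ‖y - z‖ < ε := by
  rcases hρ.eq_or_lt with rfl | hρ
  · refine ⟨ε / 3, by positivity, fun y _ z _ hy hz => ?_⟩
    obtain ⟨n, hny, hnz⟩ := (hy.and hz).exists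
    have := norm_sub_le (x n - z) (x n - y)
    rw [sub_sub_sub_cancel_left] at this
    linarith
  · obtain ⟨δ, hδ, h⟩ := exists_forall_closed_ball_dist_add_le_two_sub X
      (ε := ε / (ρ + 1)) (by positivity)
    refine ⟨min 1 (ρ * δ / 2), by positivity, fun y hyC z hzC hy hz => ?_⟩
    set η := min 1 (ρ * δ / 2)
    have hη1 : η ≤ 1 := min_le_left _ _
    have hη2 : η ≤ ρ * δ / 2 := min_le_right _ _
    have hη : 0 < η := by positivity
    have hr : 0 < ρ + η := by positivity
    by_contra! hyz
    have hmid := hC hyC hzC (a := 1 / 2) (b := 1 / 2) (by norm_num) (by norm_num) (by norm_num)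
    have hscale (v : X) : ‖(ρ + η)⁻¹ • v‖ = ‖v‖ / (ρ + η) := by
      rw [norm_smul, norm_inv, Real.norm_of_nonneg hr.le, inv_mul_eq_div]
    have hle : ρ ≤ (2 - δ) * (ρ + η) / 2 := by
      refine hlow _ hmid _ ?_
      filter_upwards [hy, hz] with n hny hnz
      have hsum := h (x := (ρ + η)⁻¹ • (x n - y)) (by rw [hscale]; exact (div_le_one hr).2 hny)
        (y := (ρ + η)⁻¹ • (x n - z)) (by rw [hscale]; exact (div_le_one hr).2 hnz) (by
          rw [← smul_sub, hscale, sub_sub_sub_cancel_left, norm_sub_rev]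
          gcongr)
      rw [← smul_add, hscale, div_le_iff₀ hr] at hsum
      have hhalf : x n - ((1 / 2 : ℝ) • y + (1 / 2 : ℝ) • z) =
          (1 / 2 : ℝ) • ((x n - y) + (x n - z)) := by module
      rw [hhalf, norm_smul, Real.norm_of_nonneg (by norm_num)]
      linarith
    nlinarith [mul_pos hδ hη, mul_pos hδ hρ, mul_pos (mul_pos hδ hρ) hδ]

/-- **Browder–Göhde–Kirk / nonstandard Picard iteration (fixed-point content of
Theorem 3.2).**  Let `X` be a uniformly convex real Banach space, `C` a nonempty
bounded closed convex subset of `X`, and `T : C → C` nonexpansive.  Then `T` has a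
fixed point in `C`. -/
theorem fixed_point_of_nonexpansive_uniformly_convex
    (X : Type*) [NormedAddCommGroup X] [NormedSpace ℝ X] [CompleteSpace X]
    [UniformConvexSpace X]
    (C : Set X) (hCne : C.Nonempty) (hCbdd : Bornology.IsBounded C)
    (hCcl : IsClosed C) (hCconv : Convex ℝ C)
    (T : X → X) (hT : Set.MapsTo T C C)
    (hTne : ∀ x ∈ C, ∀ y ∈ C, ‖T x - T y‖ ≤ ‖x - y‖) :
    ∃ z ∈ C, T z = z := by
  obtain ⟨x₀, hx₀⟩ := hCne
  let x : ℕ → X := fun n => T^[n] x₀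
  have hxC (n : ℕ) : x n ∈ C := hT.iterate n hx₀
  have hxT (n : ℕ) : x (n + 1) = T (x n) := Function.iterate_succ_apply' T n x₀
  let S : Set ℝ := {r | ∃ y ∈ C, ∀ᶠ n in atTop, ‖x n - y‖ ≤ r}
  have hS0 : ∀ r ∈ S, 0 ≤ r := by
    rintro r ⟨y, -, hy⟩
    obtain ⟨n, hn⟩ := hy.exists
    exact (norm_nonneg _).trans hn
  have hSbdd : BddBelow S := ⟨0, hS0⟩
  have hSne : S.Nonempty := by
    refine ⟨Metric.diam C, x₀, hx₀, Eventually.of_forall fun n => ?_⟩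
    rw [← dist_eq_norm]
    exact Metric.dist_le_diam_of_mem hCbdd (hxC n) hx₀
  have hclose {ε : ℝ} (hε : 0 < ε) := exists_forall_eventually_norm_sub_le_norm_sub_lt
    (l := atTop) hCconv x (Real.sInf_nonneg hS0)
    (fun z hz r hr => csInf_le hSbdd ⟨z, hz, hr⟩) hε
  have hmin (k : ℕ) : ∃ y ∈ C, ∀ᶠ n in atTop, ‖x n - y‖ ≤ sInf S + 1 / ((k : ℝ) + 1) := by
    obtain ⟨r, ⟨y, hyC, hy⟩, hr⟩ := Real.lt_sInf_add_pos hSne (Nat.one_div_pos_of_nat (n := k))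
    exact ⟨y, hyC, hy.mono fun n hn => hn.trans hr.le⟩
  choose y hyC hy using hmin
  have hyη {η : ℝ} (hη : 0 < η) :
      ∃ N, ∀ k ≥ N, ∀ᶠ n in atTop, ‖x n - y k‖ ≤ sInf S + η := by
    obtain ⟨N, hN⟩ := exists_nat_one_div_lt hη
    refine ⟨N, fun k hk => (hy k).mono fun n hn => hn.trans ?_⟩
    have := Nat.one_div_le_one_div (α := ℝ) hk
    linarith
  have hcauchy : CauchySeq y := by
    refine Metric.cauchySeq_iff.2 fun ε hε => ?_
    obtain ⟨η, hη, h⟩ := hclose hε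
    obtain ⟨N, hN⟩ := hyη hη
    refine ⟨N, fun j hj k hk => ?_⟩
    rw [dist_eq_norm]
    exact h _ (hyC j) _ (hyC k) (hN j hj) (hN k hk)
  have happrox : Tendsto (fun k => T (y k) - y k) atTop (𝓝 0) := by
    refine Metric.tendsto_atTop.2 fun ε hε => ?_
    obtain ⟨η, hη, h⟩ := hclose hε
    obtain ⟨N, hN⟩ := hyη hη
    refine ⟨N, fun k hk => ?_⟩
    rw [dist_zero_right]
    refine h _ (hT (hyC k)) _ (hyC k) ?_ (hN k hk)
    rw [← map_add_atTop_eq_nat 1, eventually_map]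
    filter_upwards [hN k hk] with n hn
    rw [hxT]
    exact (hTne _ (hxC n) _ (hyC k)).trans hn
  obtain ⟨z, hz⟩ := cauchySeq_tendsto_of_complete hcauchy
  have hzC : z ∈ C := hCcl.mem_of_tendsto hz (Eventually.of_forall hyC)
  have hTcont : ContinuousOn T C :=
    (LipschitzOnWith.of_dist_le_mul (K := 1) fun a ha b hb => by
      simpa [dist_eq_norm] using hTne a ha b hb).continuousOn
  have hTy : Tendsto (fun k => T (y k)) atTop (𝓝 (T z)) :=
    (hTcont z hzC).tendsto.comp
      (tendsto_nhdsWithin_iff.2 ⟨hz, Eventually.of_forall hyC⟩)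
  exact ⟨z, hzC, sub_eq_zero.1 (tendsto_nhds_unique (hTy.sub hz) happrox)⟩
end

section
/- Let X be a real Banach space and consider the ℝ-module of germs Germ (hyperfilter ℕ) X. Let Gal be the set of germs x whose internal norm is not an infinite hyperreal, and let mon₀ be the set of germs x whose internal norm is infinitesimal. Then Gal and mon₀ are ℝ-submodules of Germ (hyperfilter ℕ) X with mon₀ ⊆ Gal, the function assigning to the class of x ∈ Gal in the quotient module Gal/mon₀ the real number st(internal norm of x) is a well-defined norm on Gal/mon₀, and Gal/mon₀ equipped with this norm is a Banach space (the nonstandard hull of X). -/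
open Filter

/-- The internal norm of a germ `x ∈ *X = Germ (hyperfilter ℕ) X`: the hyperreal with
representative `(‖x n‖)`. -/
noncomputable def internalNorm {X : Type*} [NormedAddCommGroup X]
    (x : Germ (hyperfilter ℕ : Filter ℕ) X) : Hyperreal :=
  x.map fun a => ‖a‖

open ArchimedeanClass

section InternalNorm

variable {X : Type*} [NormedAddCommGroup X] (x y : Germ (hyperfilter ℕ : Filter ℕ) X)

theorem internalNorm_nonneg : 0 ≤ internalNorm x := by
  induction x using Germ.inductionOn with
  | h f => exact Hyperreal.ofSeq_le_ofSeq.2 (.of_forall fun n => norm_nonneg (f n))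

theorem internalNorm_zero : internalNorm (0 : Germ (hyperfilter ℕ : Filter ℕ) X) = 0 :=
  congrArg Hyperreal.ofSeq (funext fun _ => norm_zero (E := X))

theorem internalNorm_neg : internalNorm (-x) = internalNorm x := by
  induction x using Germ.inductionOn with
  | h f => exact congrArg Hyperreal.ofSeq (funext fun n => norm_neg (f n))

theorem internalNorm_add_le : internalNorm (x + y) ≤ internalNorm x + internalNorm y := by
  induction x, y using Germ.inductionOn₂ with
  | h f g => exact Hyperreal.ofSeq_le_ofSeq.2 (.of_forall fun n => norm_add_le (f n) (g n))

theorem internalNorm_smul [NormedSpace ℝ X] (r : ℝ) :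
    internalNorm (r • x) = (|r| : ℝ) * internalNorm x := by
  induction x using Germ.inductionOn with
  | h f => exact congrArg Hyperreal.ofSeq (funext fun n => norm_smul r (f n))

variable {x y}

theorem internalNorm_coe_lt {f : ℕ → X} {r : ℝ} :
    internalNorm (f : Germ (hyperfilter ℕ : Filter ℕ) X) < r ↔
      ∀ᶠ n in hyperfilter ℕ, ‖f n‖ < r :=
  Hyperreal.ofSeq_lt_ofSeq

theorem internalNorm_coe_le {f : ℕ → X} {r : ℝ} :
    internalNorm (f : Germ (hyperfilter ℕ : Filter ℕ) X) ≤ r ↔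
      ∀ᶠ n in hyperfilter ℕ, ‖f n‖ ≤ r :=
  Hyperreal.ofSeq_le_ofSeq

theorem mk_internalNorm_nonneg_of_le {r : ℝ} (h : internalNorm x ≤ r) :
    0 ≤ mk (internalNorm x) :=
  (Hyperreal.archimedeanClassMk_coe_nonneg r).trans
    (mk_antitoneOn (internalNorm_nonneg x) ((internalNorm_nonneg x).trans h) h)

theorem min_mk_internalNorm_le_mk_add :
    min (mk (internalNorm x)) (mk (internalNorm y)) ≤ mk (internalNorm (x + y)) :=
  (min_le_mk_add _ _).trans <| mk_antitoneOn (internalNorm_nonneg _)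
    (add_nonneg (internalNorm_nonneg _) (internalNorm_nonneg _)) (internalNorm_add_le x y)

theorem mk_internalNorm_le_mk_smul [NormedSpace ℝ X] (r : ℝ) :
    mk (internalNorm x) ≤ mk (internalNorm (r • x)) := by
  rw [internalNorm_smul, mk_mul]
  exact mk_le_mk_add_of_archimedean Hyperreal.coeRingHom _ _

theorem stdPart_internalNorm_add_le (hx : 0 ≤ mk (internalNorm x))
    (hy : 0 ≤ mk (internalNorm y)) :
    stdPart (internalNorm (x + y)) ≤ stdPart (internalNorm x) + stdPart (internalNorm y) := by
  rw [← stdPart_add hx hy]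
  exact stdPart_monotoneOn ((le_min hx hy).trans min_mk_internalNorm_le_mk_add)
    ((le_min hx hy).trans (min_le_mk_add _ _)) (internalNorm_add_le x y)

theorem stdPart_internalNorm_le_of_sub (hy : 0 ≤ mk (internalNorm y))
    (h : 0 < mk (internalNorm (x - y))) :
    stdPart (internalNorm x) ≤ stdPart (internalNorm y) := by
  have := stdPart_internalNorm_add_le h.le hy
  rwa [sub_add_cancel, stdPart_eq_zero.2 h.ne', zero_add] at this

end InternalNorm

/-- Given a matrix of sequences which are pairwise eventually close at rate `B` along a filter,
a diagonal sequence is eventually close to each of them at the same rate. -/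
theorem exists_eventually_norm_sub_le {X : Type*} [NormedAddCommGroup X] {l : Filter ℕ}
    (hl : l ≤ atTop) {B : ℕ → ℝ} {f : ℕ → ℕ → X}
    (hf : ∀ N n m, N ≤ n → N ≤ m → ∀ᶠ i in l, ‖f n i - f m i‖ < B N) :
    ∃ g : ℕ → X, ∀ N, ∀ᶠ i in l, ‖g i - f N i‖ ≤ B N := by
  classical
  let P (i k : ℕ) : Prop := ∀ N ≤ k, ∀ n ≤ k, N ≤ n → ‖f n i - f N i‖ < B N
  refine ⟨fun i => f (Nat.findGreatest (P i) i) i, fun N => ?_⟩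
  have hP : ∀ᶠ i in l, P i N :=
    (Set.finite_Iic N).eventually_all.2 fun M _ => (Set.finite_Iic N).eventually_all.2 fun n _ =>
      eventually_imp_distrib_left.2 fun h => hf M n M h le_rfl
  filter_upwards [hP, hl (eventually_ge_atTop N)] with i hi hNi
  have hN := Nat.le_findGreatest hNi hi
  exact (Nat.findGreatest_spec hNi hi N hN _ le_rfl hN).le

namespace NonstandardHull

variable (X : Type*) [NormedAddCommGroup X] [NormedSpace ℝ X]

/-- The galaxy of `0`: germs with finite internal norm. -/
noncomputable def galaxy : Submodule ℝ (Germ (hyperfilter ℕ : Filter ℕ) X) where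
  carrier := {x | 0 ≤ mk (internalNorm x)}
  add_mem' hx hy := by
    rw [Set.mem_ofPred_eq] at *
    exact (le_min hx hy).trans min_mk_internalNorm_le_mk_add
  zero_mem' := by simp [internalNorm_zero]
  smul_mem' r _ hx := by
    rw [Set.mem_ofPred_eq] at *
    exact hx.trans (mk_internalNorm_le_mk_smul r)

/-- The monad of `0`: germs with infinitesimal internal norm. -/
noncomputable def monad : Submodule ℝ (Germ (hyperfilter ℕ : Filter ℕ) X) where
  carrier := {x | 0 < mk (internalNorm x)}
  add_mem' hx hy := by
    rw [Set.mem_ofPred_eq] at *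
    exact (lt_min hx hy).trans_le min_mk_internalNorm_le_mk_add
  zero_mem' := by simp [internalNorm_zero]
  smul_mem' r _ hx := by
    rw [Set.mem_ofPred_eq] at *
    exact hx.trans_le (mk_internalNorm_le_mk_smul r)

variable {X} {x : Germ (hyperfilter ℕ : Filter ℕ) X}

theorem mem_galaxy : x ∈ galaxy X ↔ 0 ≤ mk (internalNorm x) :=
  Iff.rfl

theorem mem_monad : x ∈ monad X ↔ 0 < mk (internalNorm x) :=
  Iff.rfl

variable (X)

theorem monad_le_galaxy : monad X ≤ galaxy X :=
  fun _ hx => mem_galaxy.2 (mem_monad.1 hx).le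

/-- The nonstandard hull of `X`. -/
abbrev Hull : Type _ := galaxy X ⧸ (monad X).comap (galaxy X).subtype

variable {X}

/-- The standard part of the internal norm, as a function on the nonstandard hull. -/
noncomputable def hullNorm (q : Hull X) : ℝ :=
  Quotient.liftOn' q (fun x => stdPart (internalNorm x.1)) fun x y h => by
    have h : x - y ∈ (monad X).comap (galaxy X).subtype := (Submodule.quotientRel_def _).1 h
    exact le_antisymm (stdPart_internalNorm_le_of_sub (mem_galaxy.1 y.2) (mem_monad.1 h))
      (stdPart_internalNorm_le_of_sub (mem_galaxy.1 x.2) (mem_monad.1 (sub_mem_comm_iff.1 h)))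

theorem hullNorm_mk (x : galaxy X) :
    hullNorm (Submodule.Quotient.mk x) = stdPart (internalNorm x.1) :=
  rfl

noncomputable instance : NormedAddCommGroup (Hull X) :=
  AddGroupNorm.toNormedAddCommGroup
    { toFun := hullNorm
      map_zero' := by
        rw [← Submodule.Quotient.mk_zero, hullNorm_mk, Submodule.coe_zero, internalNorm_zero,
          stdPart_zero]
      add_le' := by
        rintro ⟨x⟩ ⟨y⟩
        exact stdPart_internalNorm_add_le (mem_galaxy.1 x.2) (mem_galaxy.1 y.2)
      neg' := by
        rintro ⟨x⟩
        exact congrArg stdPart (internalNorm_neg x.1)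
      eq_zero_of_map_eq_zero' := by
        rintro ⟨x⟩ h
        exact (Submodule.Quotient.mk_eq_zero _).2 <| mem_monad.2 <|
          lt_of_le_of_ne (mem_galaxy.1 x.2) (stdPart_eq_zero.1 h).symm }

theorem norm_mk (x : galaxy X) :
    ‖(Submodule.Quotient.mk x : Hull X)‖ = stdPart (internalNorm x.1) :=
  rfl

theorem norm_smul_eq (r : ℝ) (q : Hull X) : ‖r • q‖ = |r| * ‖q‖ := by
  obtain ⟨x, rfl⟩ := Submodule.Quotient.mk_surjective _ q
  rw [← Submodule.Quotient.mk_smul, norm_mk, norm_mk, Submodule.coe_smul, internalNorm_smul,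
    stdPart_mul (Hyperreal.archimedeanClassMk_coe_nonneg _) (mem_galaxy.1 x.2), Hyperreal.stdPart_coe]

instance : CompleteSpace (Hull X) := by
  refine Metric.complete_of_convergent_controlled_sequences (fun n => (1 / 2) ^ n)
    (fun n => by positivity) fun u hu => ?_
  choose x hx using fun n => Submodule.Quotient.mk_surjective _ (u n)
  choose f hf using fun n => Quot.exists_rep (x n).1
  have hf' (n : ℕ) : (x n).1 = (f n : Germ (hyperfilter ℕ : Filter ℕ) X) := (hf n).symm
  obtain ⟨g, hg⟩ := exists_eventually_norm_sub_le (l := hyperfilter ℕ) (f := f)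
    (B := fun n => (1 / 2) ^ n) Nat.hyperfilter_le_atTop fun N n m hn hm => by
      have h := hu N n m hn hm
      rw [dist_eq_norm, ← hx, ← hx, ← Submodule.Quotient.mk_sub, norm_mk] at h
      have h := lt_of_stdPart_lt Hyperreal.coeRingHom (mem_galaxy.1 (x n - x m).2) h
      rw [Submodule.coe_sub, hf', hf', ← Germ.coe_sub] at h
      exact internalNorm_coe_lt.1 h
  have hgf (n : ℕ) : internalNorm ((g : Germ (hyperfilter ℕ : Filter ℕ) X) - (x n).1) ≤
      ((1 / 2) ^ n : ℝ) := by
    rw [hf', ← Germ.coe_sub]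
    exact internalNorm_coe_le.2 (hg n)
  have hmem (n : ℕ) : (g : Germ (hyperfilter ℕ : Filter ℕ) X) - (x n).1 ∈ galaxy X :=
    mem_galaxy.2 (mk_internalNorm_nonneg_of_le (hgf n))
  have hgmem : (g : Germ (hyperfilter ℕ : Filter ℕ) X) ∈ galaxy X :=
    ((galaxy X).sub_mem_iff_left (x 0).2).1 (hmem 0)
  refine ⟨Submodule.Quotient.mk ⟨g, hgmem⟩, tendsto_iff_dist_tendsto_zero.2 <|
    squeeze_zero (fun _ => dist_nonneg) (fun n => ?_)
      (tendsto_pow_atTop_nhds_zero_of_lt_one (r := (1 / 2 : ℝ)) (by norm_num) (by norm_num))⟩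
  rw [dist_comm, dist_eq_norm, ← hx, ← Submodule.Quotient.mk_sub, norm_mk]
  exact stdPart_le_of_le Hyperreal.coeRingHom (mem_galaxy.1 (hmem n)) (hgf n)

end NonstandardHull

open NonstandardHull

/-- **The nonstandard hull of a Banach space is a Banach space.**  The sets
`Gal = {x | internalNorm x is not infinite}` and `mon₀ = {x | internalNorm x is
infinitesimal}` are `ℝ`-submodules of `Germ (hyperfilter ℕ) X` with `mon₀ ⊆ Gal`, the
function `⟦x⟧ ↦ st (internalNorm x)` is a well-defined norm on the quotient module
`Gal ⧸ mon₀` (a vector-space norm, i.e. `‖r • q‖ = |r| * ‖q‖`), and `Gal ⧸ mon₀` with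
this norm is a Banach space. -/
theorem nonstandardHull_isBanach
    (X : Type*) [NormedAddCommGroup X] [NormedSpace ℝ X] [CompleteSpace X] :
    ∃ Gal mon₀ : Submodule ℝ (Germ (hyperfilter ℕ : Filter ℕ) X),
      (Gal : Set (Germ (hyperfilter ℕ : Filter ℕ) X)) =
        {x | ¬ (internalNorm x).Infinite} ∧
      (mon₀ : Set (Germ (hyperfilter ℕ : Filter ℕ) X)) =
        {x | (internalNorm x).Infinitesimal} ∧
      mon₀ ≤ Gal ∧
      ∃ inst : NormedAddCommGroup (Gal ⧸ Submodule.comap Gal.subtype mon₀),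
        -- the norm of the class of `x ∈ Gal` is the standard part of the internal norm:
        (∀ x : Gal, @norm _ inst.toNorm (Submodule.Quotient.mk x) =
          (internalNorm (x : Germ (hyperfilter ℕ : Filter ℕ) X)).st) ∧
        -- it is a norm of the `ℝ`-vector space `Gal ⧸ mon₀`:
        (∀ (r : ℝ) (q : Gal ⧸ Submodule.comap Gal.subtype mon₀),
          @norm _ inst.toNorm (r • q) = |r| * @norm _ inst.toNorm q) ∧
        -- and the resulting normed space is complete, i.e. a Banach space:
        @CompleteSpace _ inst.toUniformSpace := by
  refine ⟨galaxy X, monad X, ?_, ?_, monad_le_galaxy X, inferInstance, fun x => ?_,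
    norm_smul_eq, inferInstance⟩
  · ext x
    exact mem_galaxy.trans <| not_lt.symm.trans (not_congr Hyperreal.infinite_iff.symm)
  · ext x
    exact mem_monad.trans Hyperreal.infinitesimal_iff.symm
  · rw [Hyperreal.st_eq]
    exact norm_mk x
end

section
/- Let (M, ρ) be a complete metric space, let T_n : M → M be a sequence of mappings and k_n a sequence of reals such that, for hyperfilter-almost every n, one has 0 < k_n < 1 and ρ(T_n x, T_n y) ≤ k_n · ρ(x, y) for all x, y ∈ M. Then there exists exactly one germ z ∈ Germ (hyperfilter ℕ) M fixed by the germ of the sequence (T_n), i.e., exactly one z having a representative (z_n) with T_n z_n = z_n for hyperfilter-almost every n. -/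
open Filter

/-- **Fixed-point content of the internal Banach Contraction Principle (Theorem 3.1).**
Let `(M, ρ)` be a complete metric space and let `T n : M → M`, `k n ∈ ℝ` be such that,
for hyperfilter-almost every `n`, `0 < k n < 1` and `T n` is a `k n`-contraction.  Then
there is exactly one germ `z ∈ Germ (hyperfilter ℕ) M` fixed by the germ of `(T n)`,
i.e. exactly one `z` with a representative `(z n)` satisfying `T n (z n) = z n` for
hyperfilter-almost every `n`. -/
theorem internal_contraction_unique_fixed_point
    (M : Type*) [MetricSpace M] [CompleteSpace M] [Nonempty M]
    (T : ℕ → M → M) (k : ℕ → ℝ)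
    (h : ∀ᶠ n in (hyperfilter ℕ : Filter ℕ), 0 < k n ∧ k n < 1 ∧
      ∀ x y : M, dist (T n x) (T n y) ≤ k n * dist x y) :
    ∃! z : Germ (hyperfilter ℕ : Filter ℕ) M,
      ∃ zr : ℕ → M, (Germ.ofFun zr : Germ (hyperfilter ℕ : Filter ℕ) M) = z ∧
        ∀ᶠ n in (hyperfilter ℕ : Filter ℕ), T n (zr n) = zr n := by
  have contracting : ∀ᶠ n in (hyperfilter ℕ : Filter ℕ), ∃ K, ContractingWith K (T n) :=
    h.mono fun n ⟨hpos, hlt, hdist⟩ =>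
      ⟨⟨k n, hpos.le⟩, NNReal.coe_lt_coe.mp hlt, LipschitzWith.of_dist_le_mul hdist⟩
  have exists_fixed : ∀ᶠ n in (hyperfilter ℕ : Filter ℕ), ∃ x, T n x = x :=
    contracting.mono fun n ⟨_, hK⟩ => ⟨hK.fixedPoint, hK.fixedPoint_isFixedPt⟩
  obtain ⟨z, hz⟩ := exists_fixed.choice
  refine ⟨Germ.ofFun z, ⟨z, rfl, hz⟩, ?_⟩
  rintro _ ⟨w, rfl, hw⟩
  refine Germ.coe_eq.mpr ?_
  filter_upwards [contracting, hz, hw] with n ⟨_, hK⟩ hzn hwn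
  exact hK.fixedPoint_unique' hwn hzn
end

section
/- Let M be a nonempty set and for each n ∈ ℕ let (A_n^j)_{j ∈ ℕ} be a sequence of subsets of M. Let Ã_n ⊆ Germ (hyperfilter ℕ) M be the set of germs having a representative (x_j) with x_j ∈ A_n^j for hyperfilter-almost every j. If the family {Ã_n : n ∈ ℕ} has the finite intersection property (every finite subfamily has nonempty intersection), then ⋂_{n ∈ ℕ} Ã_n ≠ ∅. -/
open Filter

/-- Finitely many of the sets `A 0 j, A 1 j, …` having a common point for `l`-almost every `j`
suffices for a single sequence to lie `l`-almost everywhere in each `A n j`. -/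
theorem exists_forall_eventually_mem {M : Type*} [Nonempty M] {l : Filter ℕ} (hl : l ≤ atTop)
    (A : ℕ → ℕ → Set M) (h : ∀ N, ∀ᶠ j in l, ∃ a, ∀ n < N, a ∈ A n j) :
    ∃ x : ℕ → M, ∀ n, ∀ᶠ j in l, x j ∈ A n j := by
  classical
  have key : ∀ j, ∃ a, ∀ N ≤ j, (∃ b, ∀ n < N, b ∈ A n j) → ∀ n < N, a ∈ A n j := by
    intro j
    have h0 : ∃ b, ∀ n < 0, b ∈ A n j := ⟨Classical.arbitrary M, by simp⟩
    obtain ⟨a, ha⟩ := Nat.findGreatest_spec (P := fun N => ∃ b, ∀ n < N, b ∈ A n j) j.zero_le h0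
    exact ⟨a, fun N hN hb n hn => ha n (hn.trans_le (Nat.le_findGreatest hN hb))⟩
  choose x hx using key
  refine ⟨x, fun n => ?_⟩
  filter_upwards [h (n + 1), hl (eventually_ge_atTop (n + 1))] with j hj hnj
  exact hx j (n + 1) hnj hj n n.lt_succ_self

/-- **Countable saturation.**  Let `M` be a nonempty set and for each `n` let
`(A n j)_j` be a sequence of subsets of `M`.  Let `Ã n` be the set of germs in
`Germ (hyperfilter ℕ) M` having a representative `(x j)` with `x j ∈ A n j` for
hyperfilter-almost every `j`.  If the family `{Ã n : n ∈ ℕ}` has the finite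
intersection property, then `⋂ n, Ã n ≠ ∅`. -/
theorem countable_saturation
    (M : Type*) [Nonempty M] (A : ℕ → ℕ → Set M)
    (hfip : ∀ F : Finset ℕ,
      (⋂ n ∈ F, {g : Germ (hyperfilter ℕ : Filter ℕ) M |
        ∃ x : ℕ → M, (Germ.ofFun x : Germ (hyperfilter ℕ : Filter ℕ) M) = g ∧
          ∀ᶠ j in (hyperfilter ℕ : Filter ℕ), x j ∈ A n j}).Nonempty) :
    (⋂ n : ℕ, {g : Germ (hyperfilter ℕ : Filter ℕ) M |
      ∃ x : ℕ → M, (Germ.ofFun x : Germ (hyperfilter ℕ : Filter ℕ) M) = g ∧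
        ∀ᶠ j in (hyperfilter ℕ : Filter ℕ), x j ∈ A n j}).Nonempty := by
  have hcommon : ∀ N, ∀ᶠ j in (hyperfilter ℕ : Filter ℕ), ∃ a, ∀ n < N, a ∈ A n j := by
    intro N
    obtain ⟨g, hg⟩ := hfip (Finset.range N)
    induction g using Germ.inductionOn with | _ y
    have hy : ∀ n ∈ Finset.range N, ∀ᶠ j in (hyperfilter ℕ : Filter ℕ), y j ∈ A n j := by
      intro n hn
      obtain ⟨x, hxy, hx⟩ := Set.mem_iInter₂.1 hg n hn
      filter_upwards [hx, Germ.coe_eq.1 hxy] with j hj hxyj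
      exact hxyj ▸ hj
    filter_upwards [(eventually_all_finset _).2 hy] with j hj
    exact ⟨y j, fun n hn => hj n (Finset.mem_range.2 hn)⟩
  obtain ⟨x, hx⟩ := exists_forall_eventually_mem Nat.hyperfilter_le_atTop A hcommon
  exact ⟨Germ.ofFun x, Set.mem_iInter.2 fun n => ⟨x, rfl, hx n⟩⟩
end

section
/- Let C be a nonempty convex subset of a real Banach space X that is compact in the weak topology, and let T : C → C be nonexpansive. Then there exists a nonempty closed convex subset K ⊆ C with T(K) ⊆ K that is minimal with respect to these properties: every nonempty closed convex subset K' ⊆ K with T(K') ⊆ K' equals K. Moreover, if T has no fixed point in C, then any such minimal K is not a singleton. -/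
/-- A weakly compact set is closed in the norm topology. -/
theorem isClosed_of_isCompact_image_toWeakSpace {X : Type*} [NormedAddCommGroup X]
    [NormedSpace ℝ X] {C : Set X} (hC : IsCompact (toWeakSpace ℝ X '' C)) : IsClosed C := by
  rw [← Set.preimage_image_eq C (toWeakSpace ℝ X).injective]
  exact hC.isClosed.preimage (toWeakSpaceCLM ℝ X).continuous

/-- The image of a closed convex set in the weak space is closed. -/
theorem Convex.isClosed_image_toWeakSpace {X : Type*} [NormedAddCommGroup X]
    [NormedSpace ℝ X] {K : Set X} (hK : Convex ℝ K) (hcl : IsClosed K) :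
    IsClosed (toWeakSpace ℝ X '' K) := by
  rw [← closure_eq_iff_isClosed, ← hK.toWeakSpace_closure ℝ, hcl.closure_eq]

/-- A nonempty chain of nonempty closed convex subsets of a weakly compact set has nonempty
intersection. -/
theorem IsChain.nonempty_sInter_of_isCompact_image_toWeakSpace {X : Type*}
    [NormedAddCommGroup X] [NormedSpace ℝ X] {C : Set X}
    (hC : IsCompact (toWeakSpace ℝ X '' C)) {c : Set (Set X)} (hc : IsChain (· ⊆ ·) c)
    (hne : c.Nonempty) (hsub : ∀ K ∈ c, K ⊆ C) (hK : ∀ K ∈ c, K.Nonempty)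
    (hcl : ∀ K ∈ c, IsClosed K) (hconv : ∀ K ∈ c, Convex ℝ K) : (⋂₀ c).Nonempty := by
  have := hne.to_subtype
  have hclosed (K : c) : IsClosed (toWeakSpace ℝ X '' (K : Set X)) :=
    (hconv K K.2).isClosed_image_toWeakSpace (hcl K K.2)
  have hdir : Directed (· ⊇ ·) fun K : c => toWeakSpace ℝ X '' (K : Set X) := by
    intro K L
    rcases hc.total K.2 L.2 with h | h
    · exact ⟨K, subset_rfl, Set.image_mono h⟩
    · exact ⟨L, Set.image_mono h, subset_rfl⟩
  obtain ⟨y, hy⟩ := IsCompact.nonempty_iInter_of_directed_nonempty_isCompact_isClosed _ hdir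
    (fun K => (hK K K.2).image _)
    (fun K => hC.of_isClosed_subset (hclosed K) (Set.image_mono (hsub K K.2))) hclosed
  refine ⟨(toWeakSpace ℝ X).symm y, fun K hKc => ?_⟩
  obtain ⟨x, hx, rfl⟩ := Set.mem_iInter.1 hy ⟨K, hKc⟩
  simpa using hx


/-- **Minimal invariant sets.**  Let `C` be a nonempty convex weakly compact subset of a
real Banach space `X` and `T : C → C` nonexpansive.  Then there is a nonempty closed
convex `T`-invariant `K ⊆ C` which is minimal with respect to these properties.
Moreover, if `T` has no fixed point in `C`, then no such minimal `K` is a singleton. -/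
theorem exists_minimal_invariant_set
    (X : Type*) [NormedAddCommGroup X] [NormedSpace ℝ X] [CompleteSpace X]
    (C : Set X) (hCne : C.Nonempty) (hCconv : Convex ℝ C)
    (hCcpt : IsCompact (toWeakSpace ℝ X '' C))
    (T : X → X) (hT : Set.MapsTo T C C)
    (hTne : ∀ x ∈ C, ∀ y ∈ C, ‖T x - T y‖ ≤ ‖x - y‖) :
    (∃ K ⊆ C, K.Nonempty ∧ IsClosed K ∧ Convex ℝ K ∧ Set.MapsTo T K K ∧
      ∀ K' ⊆ K, K'.Nonempty → IsClosed K' → Convex ℝ K' → Set.MapsTo T K' K' →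
        K' = K) ∧
    ((¬ ∃ z ∈ C, T z = z) →
      ∀ K ⊆ C, K.Nonempty → IsClosed K → Convex ℝ K → Set.MapsTo T K K →
        (∀ K' ⊆ K, K'.Nonempty → IsClosed K' → Convex ℝ K' → Set.MapsTo T K' K' →
          K' = K) →
        ¬ ∃ x : X, K = {x}) := by
  refine ⟨?_, ?_⟩
  · let S : Set (Set X) :=
      {K | K ⊆ C ∧ K.Nonempty ∧ IsClosed K ∧ Convex ℝ K ∧ Set.MapsTo T K K}
    have hchain : ∀ c ⊆ S, IsChain (· ⊆ ·) c → c.Nonempty → ∃ lb ∈ S, ∀ s ∈ c, lb ⊆ s := by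
      intro c hcS hc hne
      obtain ⟨K₀, hK₀⟩ := hne
      refine ⟨⋂₀ c, ⟨(Set.sInter_subset_of_mem hK₀).trans (hcS hK₀).1, ?_,
        isClosed_sInter fun K hK => (hcS hK).2.2.1,
        convex_sInter fun K hK => (hcS hK).2.2.2.1,
        fun x hx K hK => (hcS hK).2.2.2.2 (hx K hK)⟩, fun K hK => Set.sInter_subset_of_mem hK⟩
      exact hc.nonempty_sInter_of_isCompact_image_toWeakSpace hCcpt ⟨K₀, hK₀⟩
        (fun K hK => (hcS hK).1) (fun K hK => (hcS hK).2.1)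
        (fun K hK => (hcS hK).2.2.1) (fun K hK => (hcS hK).2.2.2.1)
    obtain ⟨K, hKC, ⟨-, hne, hcl, hconv, hmaps⟩, hKmin⟩ := zorn_superset_nonempty S hchain C
      ⟨subset_rfl, hCne, isClosed_of_isCompact_image_toWeakSpace hCcpt, hCconv, hT⟩
    exact ⟨K, hKC, hne, hcl, hconv, hmaps, fun K' hK' hne' hcl' hconv' hmaps' =>
      hK'.antisymm (hKmin ⟨hK'.trans hKC, hne', hcl', hconv', hmaps'⟩ hK')⟩
  · rintro hfix K hKC - - - hmaps - ⟨x, rfl⟩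
    exact hfix ⟨x, hKC rfl, hmaps rfl⟩
end
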